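/- arXiv:1906.03898 — 6 statements merged into one kernel-verified Lean document; each statement's English description precedes it below -/
import Mathlib

section
/- (Consistency of the system Σ_N.) Let N ≥ 1 be an integer, α ∈ ℝ with α ≠ 0, and u : ℤ × ℤ → ℝ. Suppose that for every i with 1 ≤ i ≤ N and all (n,m) ∈ ℤ², Q_{(i,N+1−i)}(n,m) + (−1)^{N−i}·α = 0. Define F_i(n,m) = Q_{(i−1,N+1−i)}(n,m) + Q_{(i,N−i)}(n,m) for 1 ≤ i ≤ N. Then for every ℓ with 1 ≤ ℓ ≤ N−1 and all (n,m) ∈ ℤ², F_ℓ(n+1,m) + F_{ℓ+1}(n,m+1) = 0. -/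
/-- The lattice-path polynomials `Q_{(i,j)}` built from `u : ℤ × ℤ → ℝ`. -/
noncomputable def Qp (u : ℤ → ℤ → ℝ) : ℕ → ℕ → ℤ → ℤ → ℝ
  | 0, 0, n, m => u n m
  | i+1, 0, n, m => Qp u i 0 n m * u (n + (i+1 : ℕ)) m
  | 0, j+1, n, m => Qp u 0 j n m * u n (m + (j+1 : ℕ))
  | i+1, j+1, n, m => (Qp u (i+1) j n m + Qp u i (j+1) n m) * u (n + (i+1 : ℕ)) (m + (j+1 : ℕ))

/-- `F_i = Q_{(i-1,N+1-i)} + Q_{(i,N-i)}`. -/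
noncomputable def Fp (u : ℤ → ℤ → ℝ) (N i : ℕ) (n m : ℤ) : ℝ :=
  Qp u (i - 1) (N + 1 - i) n m + Qp u i (N - i) n m

/-- consistency of the system `Σ_N`.  If
`Q_{(i,N+1-i)} + (-1)^{N-i} α = 0` for `i = 1, …, N` at all lattice points, then
`F_ℓ(n+1,m) + F_{ℓ+1}(n,m+1) = 0` for `ℓ = 1, …, N-1`. -/
theorem SigmaN_consistent (u : ℤ → ℤ → ℝ) (N : ℕ) (hN : 1 ≤ N)
    (α : ℝ) (hα : α ≠ 0)
    (hsys : ∀ i : ℕ, 1 ≤ i → i ≤ N → ∀ n m : ℤ,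
      Qp u i (N + 1 - i) n m + (-1 : ℝ) ^ (N - i) * α = 0)
    (ℓ : ℕ) (hℓ1 : 1 ≤ ℓ) (hℓ2 : ℓ ≤ N - 1) (n m : ℤ) :
    Fp u N ℓ (n + 1) m + Fp u N (ℓ + 1) n (m + 1) = 0 := by
  obtain ⟨p, rfl⟩ : ∃ p, ℓ = p + 1 := ⟨ℓ - 1, by omega⟩
  obtain ⟨k, rfl⟩ : ∃ k, N = p + k + 2 := ⟨N - p - 2, by omega⟩
  have h₁ := hsys (p + 1) (by omega) (by omega) (n + 1) m
  have h₂ := hsys (p + 2) (by omega) (by omega) n (m + 1)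
  rw [show p + k + 2 + 1 - (p + 1) = k + 1 + 1 by omega,
    show p + k + 2 - (p + 1) = k + 1 by omega, Qp] at h₁
  rw [show p + k + 2 + 1 - (p + 2) = k + 1 by omega,
    show p + k + 2 - (p + 2) = k by omega, Qp] at h₂
  -- Both equations evaluate `u` at the same lattice point.
  rw [show n + ((p + 1 + 1 : ℕ) : ℤ) = n + 1 + ((p + 1 : ℕ) : ℤ) by push_cast; ring,
    show m + 1 + ((k + 1 : ℕ) : ℤ) = m + ((k + 1 + 1 : ℕ) : ℤ) by push_cast; ring] at h₂
  simp only [Fp, show p + 1 - 1 = p by omega, show p + 1 + 1 - 1 = p + 1 by omega,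
    show p + k + 2 + 1 - (p + 1) = k + 1 + 1 by omega,
    show p + k + 2 - (p + 1) = k + 1 by omega,
    show p + k + 2 + 1 - (p + 1 + 1) = k + 1 by omega,
    show p + k + 2 - (p + 1 + 1) = k by omega]
  have hu : u (n + 1 + ((p + 1 : ℕ) : ℤ)) (m + ((k + 1 + 1 : ℕ) : ℤ)) ≠ 0 := by
    intro h
    rw [h, mul_zero, zero_add] at h₂
    exact mul_ne_zero (pow_ne_zero k (by norm_num)) hα h₂
  refine (mul_eq_zero.mp ?_).resolve_right hu
  rw [pow_succ] at h₁
  linear_combination h₁ + h₂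
end

section
/- Let N ≥ 1, α ∈ ℝ, and u : ℝ → ℤ × ℤ → ℝ. For each t let Q^t_{(i,j)} denote the polynomials built from u(t,·,·), and assume Q^t_{(N+1,0)}(n,m) − α ≠ 0 for all t, n, m. Define G(t,n,m) = ∏_{k=0}^{N} (Q^t_{(N+1,0)}(n+k−N−1, m) − α)⁻¹, and suppose that for every (n,m) and every t the function t ↦ u(t,n,m) has derivative u(t,n,m)·(G(t,n+1,m) − G(t,n,m)) at t. If at some time t₀ the equation Q^{t₀}_{(N,1)}(n,m) + α = 0 holds for all (n,m) ∈ ℤ², then for every (n,m) the function t ↦ Q^t_{(N,1)}(n,m) has derivative 0 at t₀. (That is, the flow ∂_t u_{0,0} = u_{0,0}(S−1)∏_{k=0}^{N} S^{k−N−1}(1/(Q_{(N+1,0)} − α)) is a generalized symmetry of the equation Q_{(N,1)} + α = 0.) -/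
open Finset in
theorem Qp_zero_right (u : ℤ → ℤ → ℝ) (i : ℕ) (n m : ℤ) :
    Qp u i 0 n m = ∏ j ∈ Ico 0 (i + 1), u (n + (j : ℤ)) m := by
  induction i with
  | zero => simp [Qp]
  | succ i ih => rw [Qp, ih, prod_Ico_succ_top (Nat.zero_le (i + 1))]

/-- The product of `x` along a horizontal path from `a` to `a + k`, times the product of `y` from
`a + k` to `a + i`. -/
noncomputable def pathWeight (x y : ℤ → ℝ) (i : ℕ) (a : ℤ) (k : ℕ) : ℝ :=
  (∏ j ∈ Finset.Ico 0 (k + 1), x (a + (j : ℤ))) * ∏ j ∈ Finset.Ico k (i + 1), y (a + (j : ℤ))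

open Finset in
theorem Qp_one_right (u : ℤ → ℤ → ℝ) (i : ℕ) (n m : ℤ) :
    Qp u i 1 n m =
      ∑ k ∈ range (i + 1), pathWeight (fun a => u a m) (fun a => u a (m + 1)) i n k := by
  induction i with
  | zero => simp [Qp, pathWeight]
  | succ i ih =>
    have hstep : ∀ k ∈ range (i + 1),
        pathWeight (fun a => u a m) (fun a => u a (m + 1)) (i + 1) n k =
          pathWeight (fun a => u a m) (fun a => u a (m + 1)) i n k
            * u (n + ((i + 1 : ℕ) : ℤ)) (m + 1) := by
      intro k hk
      have hk : k ≤ i + 1 := (mem_range.mp hk).le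
      simp only [pathWeight]
      rw [prod_Ico_succ_top hk, mul_assoc]
    rw [Qp, ih, Qp_zero_right, sum_range_succ _ (i + 1), sum_congr rfl hstep, ← sum_mul]
    simp only [pathWeight, Nat.Ico_succ_singleton, prod_singleton]
    push_cast
    ring_nf

section Algebra

variable {x y : ℤ → ℝ}

theorem pathWeight_succ_right {i k : ℕ} (hk : k ≤ i) (a : ℤ) :
    pathWeight x y i a (k + 1) * y (a + (k : ℤ)) =
      pathWeight x y i a k * x (a + (k : ℤ) + 1) := by
  have hy := Finset.prod_eq_prod_Ico_succ_bot (show k < i + 1 by omega)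
    (fun j : ℕ => y (a + (j : ℤ)))
  have hx := Finset.prod_Ico_succ_top (Nat.zero_le (k + 1)) (fun j : ℕ => x (a + (j : ℤ)))
  simp only [pathWeight, hy, hx]
  push_cast
  ring_nf

theorem prod_Ico_zero_succ_shift (x : ℤ → ℝ) (a : ℤ) (k : ℕ) :
    ∏ j ∈ Finset.Ico 0 (k + 1), x (a + (j : ℤ)) =
      x a * ∏ j ∈ Finset.Ico 0 k, x (a + 1 + (j : ℤ)) := by
  rw [← Finset.range_eq_Ico, ← Finset.range_eq_Ico, Finset.prod_range_succ', mul_comm]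
  simp [add_comm, add_left_comm]

theorem pathWeight_succ_succ (i k : ℕ) (a : ℤ) :
    pathWeight x y (i + 1) a (k + 1) = x a * pathWeight x y i (a + 1) k := by
  have hy : ∏ j ∈ Finset.Ico (k + 1) (i + 1 + 1), y (a + (j : ℤ)) =
      ∏ j ∈ Finset.Ico k (i + 1), y (a + 1 + (j : ℤ)) := by
    rw [← Finset.prod_Ico_add' (fun j : ℕ => y (a + (j : ℤ))) k (i + 1) 1]
    refine Finset.prod_congr rfl fun j _ => ?_
    push_cast
    ring_nf
  rw [pathWeight, pathWeight, prod_Ico_zero_succ_shift, hy, mul_assoc]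

/-- Solutions of `∑ k, pathWeight x y N a k = -α` satisfy a relation between the two rows. -/
theorem row_relation {N : ℕ} {α : ℝ}
    (hsol : ∀ a, ∑ k ∈ Finset.range (N + 1), pathWeight x y N a k = -α) (a : ℤ) :
    x a * (∏ j ∈ Finset.Ico 0 (N + 2), y (a + (j : ℤ)) - α) =
      y (a + (N : ℤ) + 1) * (∏ j ∈ Finset.Ico 0 (N + 2), x (a + (j : ℤ)) - α) := by
  have hfirst := Finset.sum_range_succ' (fun k => pathWeight x y (N + 1) a k) (N + 1)
  have hlast := Finset.sum_range_succ (fun k => pathWeight x y (N + 1) a k) (N + 1)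
  have hstep : ∀ k ∈ Finset.range (N + 1),
      pathWeight x y (N + 1) a k = pathWeight x y N a k * y (a + (N : ℤ) + 1) := by
    intro k hk
    have hk : k ≤ N + 1 := (Finset.mem_range.mp hk).le
    rw [pathWeight, pathWeight, Finset.prod_Ico_succ_top hk]
    push_cast
    ring_nf
  simp only [pathWeight_succ_succ, ← Finset.mul_sum, hsol] at hfirst
  rw [Finset.sum_congr rfl hstep, ← Finset.sum_mul, hsol, hfirst] at hlast
  simp only [pathWeight, Nat.Ico_succ_singleton, Finset.prod_singleton, zero_add,
    Nat.cast_zero, add_zero] at hlast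
  push_cast at hlast
  rw [← add_assoc] at hlast
  linear_combination hlast

theorem prod_inv_shift {N : ℕ} {P X : ℤ → ℝ} (hP : ∀ a, P a ≠ 0)
    (hX : ∀ a, X a = ∏ k ∈ Finset.range (N + 1), (P (a + (k : ℤ) - (N : ℤ) - 1))⁻¹) (a : ℤ) :
    X (a + 1) * P a = X a * P (a - (N : ℤ) - 1) := by
  rw [hX, hX, Finset.prod_range_succ, Finset.prod_range_succ']
  have h : ∀ k : ℕ, a + 1 + (k : ℤ) - N - 1 = a + ((k + 1 : ℕ) : ℤ) - N - 1 := by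
    intro k
    push_cast
    ring
  have hN : a + ((N + 1 : ℕ) : ℤ) - (N : ℤ) - 1 = a := by
    push_cast
    ring
  simp only [h, hN, Nat.cast_zero, add_zero]
  field_simp [hP]

/-- The sum that is the obstruction to the symmetry telescopes. -/
theorem sum_pathWeight_mul_sub {N : ℕ} {α : ℝ} {P R X Y : ℤ → ℝ}
    (hx : ∀ a, x a ≠ 0) (hy : ∀ a, y a ≠ 0) (hP : ∀ a, P a ≠ 0) (hR : ∀ a, R a ≠ 0)
    (hPx : ∀ a, P a = ∏ j ∈ Finset.Ico 0 (N + 2), x (a + (j : ℤ)) - α)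
    (hRy : ∀ a, R a = ∏ j ∈ Finset.Ico 0 (N + 2), y (a + (j : ℤ)) - α)
    (hrel : ∀ a, x a * R a = y (a + (N : ℤ) + 1) * P a)
    (hX : ∀ a, X a = ∏ k ∈ Finset.range (N + 1), (P (a + (k : ℤ) - (N : ℤ) - 1))⁻¹)
    (hY : ∀ a, Y a = ∏ k ∈ Finset.range (N + 1), (R (a + (k : ℤ) - (N : ℤ) - 1))⁻¹) (a : ℤ) :
    ∑ k ∈ Finset.range (N + 1), pathWeight x y N a k * (X (a + (k : ℤ) + 1) - Y (a + (k : ℤ))) =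
      α * (Y (a + (N : ℤ) + 1) - X a) := by
  have hXs := prod_inv_shift hP hX
  have hYs := prod_inv_shift hR hY
  have shift : ∀ {z S : ℤ → ℝ}, (∀ a, S a = ∏ j ∈ Finset.Ico 0 (N + 2), z (a + (j : ℤ)) - α) →
      ∀ a, (S (a + 1) + α) * z a = (S a + α) * z (a + (N : ℤ) + 2) := by
    intro z S hS a
    have h1 := prod_Ico_zero_succ_shift z a (N + 2)
    rw [Finset.prod_Ico_succ_top (Nat.zero_le _)] at h1
    push_cast at h1
    rw [← add_assoc] at h1
    rw [hS, hS]
    linear_combination -h1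
  have hPs := shift hPx
  have hRs := shift hRy
  let w : ℕ → ℝ := fun k => X a * ∏ j ∈ Finset.range k, P (a + (j : ℤ) - N - 1) / R (a + (j : ℤ))
  have hw0 : w 0 = X a := by simp [w]
  have hws : ∀ k : ℕ, w (k + 1) * R (a + (k : ℤ)) = w k * P (a + (k : ℤ) - N - 1) := by
    intro k
    simp only [w, Finset.prod_range_succ]
    have := hR (a + (k : ℤ))
    field_simp
  have hwN : w (N + 1) = Y (a + (N : ℤ) + 1) := by
    simp only [w]
    rw [hX, hY, ← Finset.prod_mul_distrib]
    refine Finset.prod_congr rfl fun k _ => ?_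
    have h : a + (N : ℤ) + 1 + k - N - 1 = a + k := by ring
    rw [h]
    have := hP (a + (k : ℤ) - N - 1)
    field_simp
  have hA : ∀ k : ℕ, k ≤ N →
      pathWeight x y N a k * X (a + (k : ℤ) + 1) = w (k + 1) * (R (a + (k : ℤ)) + α) := by
    intro k
    induction k with
    | zero =>
      intro _
      have h1 := hXs a
      have h2 := hws 0
      have h3 := hrel a
      have h4 := hRy a
      rw [Finset.prod_Ico_succ_top (Nat.zero_le _)] at h4
      simp only [pathWeight, Nat.cast_zero, add_zero, zero_add, Nat.Ico_succ_singleton,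
        Finset.prod_singleton, hw0] at *
      push_cast at h4
      rw [← add_assoc] at h4
      set p := ∏ j ∈ Finset.Ico 0 (N + 1), y (a + (j : ℤ))
      apply mul_right_cancel₀ (mul_ne_zero (hP a) (hR a))
      linear_combination (p * x a * R a) * h1 + p * X a * P (a - N - 1) * h3
        - (R a + α) * P a * h2 - P a * X a * P (a - N - 1) * h4
    | succ k ih =>
      intro hk
      have ih := ih (by omega)
      have h1 := hXs (a + k + 1)
      have h2 := hws (k + 1)
      have h3 := hrel (a + k + 1)
      have h4 := hRs (a + k)
      have h5 := pathWeight_succ_right (x := x) (y := y) (show k ≤ N by omega) a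
      push_cast at *
      have e1 : a + (k : ℤ) + N + 2 = a + k + 1 + N + 1 := by ring
      rw [e1] at h4
      rw [← add_assoc] at *
      set b := a + (k : ℤ)
      apply mul_right_cancel₀ (mul_ne_zero (mul_ne_zero (hP (b + 1)) (hR (b + 1))) (hy b))
      linear_combination (pathWeight x y N a (k + 1) * R (b + 1) * y b) * h1
        + X (b + 1) * P (b + 1 - N - 1) * R (b + 1) * h5
        + P (b + 1 - N - 1) * R (b + 1) * x (b + 1) * ih
        + P (b + 1 - N - 1) * w (k + 1) * (R b + α) * h3
        - P (b + 1) * (R (b + 1) + α) * y b * h2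
        - P (b + 1) * P (b + 1 - N - 1) * w (k + 1) * h4
  have hB : ∀ k : ℕ, k ≤ N →
      pathWeight x y N a k * Y (a + (k : ℤ)) = w k * (P (a + (k : ℤ) - N - 1) + α) := by
    intro k
    induction k with
    | zero =>
      intro _
      have h4 := hPx (a - N - 1)
      rw [Finset.prod_Ico_succ_top (Nat.zero_le _)] at h4
      have hXY : Y a * ∏ j ∈ Finset.Ico 0 (N + 1), y (a + (j : ℤ)) =
          X a * ∏ j ∈ Finset.Ico 0 (N + 1), x (a - N - 1 + (j : ℤ)) := by
        rw [hX, hY, ← Finset.range_eq_Ico, ← Finset.prod_mul_distrib, ← Finset.prod_mul_distrib]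
        refine Finset.prod_congr rfl fun k _ => ?_
        have h := hrel (a + k - N - 1)
        have e1 : a + (k : ℤ) - N - 1 + N + 1 = a + k := by ring
        have e2 : a - N - 1 + (k : ℤ) = a + k - N - 1 := by ring
        rw [e1] at h
        rw [e2]
        have hp := hP (a + k - N - 1)
        have hr := hR (a + k - N - 1)
        field_simp
        linear_combination -h
      have e : a - (N : ℤ) - 1 + ((N + 1 : ℕ) : ℤ) = a := by
        push_cast
        ring
      rw [e] at h4
      simp only [pathWeight, Nat.cast_zero, add_zero, zero_add, Nat.Ico_succ_singleton,
        Finset.prod_singleton, hw0]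
      linear_combination x a * hXY - X a * h4
    | succ k ih =>
      intro hk
      have ih := ih (by omega)
      have h1 := hYs (a + k)
      have h2 := hws k
      have h3 := hrel (a + k - N - 1)
      have h4 := hPs (a + k - N - 1)
      have h5 := pathWeight_succ_right (x := x) (y := y) (show k ≤ N by omega) a
      push_cast at *
      have e1 : a + (k : ℤ) - N - 1 + N + 1 = a + k := by ring
      have e2 : a + (k : ℤ) - N - 1 + N + 2 = a + k + 1 := by ring
      have e3 : a + (k : ℤ) - N - 1 + 1 = a + k + 1 - N - 1 := by ring
      rw [e1] at h3
      rw [e2, e3] at h4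
      rw [← add_assoc] at *
      set b := a + (k : ℤ)
      set c := b - (N : ℤ) - 1
      set T := pathWeight x y N a (k + 1)
      apply mul_right_cancel₀ (mul_ne_zero (mul_ne_zero (hR b) (hy b)) (hx c))
      linear_combination T * y b * x c * h1 + Y b * R c * x c * h5 + R c * x c * x (b + 1) * ih
        + w k * (P c + α) * x (b + 1) * h3 - (P (b + 1 - N - 1) + α) * y b * x c * h2
        - w k * P c * y b * h4
  have hterm : ∀ k ∈ Finset.range (N + 1),
      pathWeight x y N a k * (X (a + (k : ℤ) + 1) - Y (a + (k : ℤ))) =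
        α * (w (k + 1) - w k) := by
    intro k hk
    have hk : k ≤ N := Nat.lt_succ_iff.mp (Finset.mem_range.mp hk)
    linear_combination hA k hk - hB k hk + hws k
  rw [Finset.sum_congr rfl hterm, ← Finset.mul_sum, Finset.sum_range_sub, hwN, hw0]

theorem ne_zero_of_sum_pathWeight {N : ℕ} {α : ℝ}
    (hsol : ∀ a, ∑ k ∈ Finset.range (N + 1), pathWeight x y N a k = -α) (hα : α ≠ 0) (a : ℤ) :
    x a ≠ 0 ∧ y a ≠ 0 := by
  constructor
  · intro h
    have := hsol a
    rw [Finset.sum_eq_zero fun k _ => by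
      rw [pathWeight, prod_Ico_zero_succ_shift, h, zero_mul, zero_mul]] at this
    exact hα (by linarith)
  · intro h
    have := hsol (a - N)
    rw [Finset.sum_eq_zero fun k hk => by
      have hk : k ≤ N := Nat.lt_succ_iff.mp (Finset.mem_range.mp hk)
      rw [pathWeight, Finset.prod_Ico_succ_top hk, sub_add_cancel, h, mul_zero, mul_zero]] at this
    exact hα (by linarith)

end Algebra

theorem hasDerivAt_prod_Ico {v : ℝ → ℤ → ℝ} {g : ℤ → ℝ} {t : ℝ}
    (h : ∀ a, HasDerivAt (fun s => v s a) (v t a * (g (a + 1) - g a)) t) (a : ℤ) {k l : ℕ}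
    (hkl : k ≤ l) :
    HasDerivAt (fun s => ∏ j ∈ Finset.Ico k l, v s (a + (j : ℤ)))
      ((∏ j ∈ Finset.Ico k l, v t (a + (j : ℤ))) * (g (a + (l : ℤ)) - g (a + (k : ℤ)))) t := by
  induction l, hkl using Nat.le_induction with
  | base => simpa using hasDerivAt_const t (1 : ℝ)
  | succ l hkl ih =>
    simp only [Finset.prod_Ico_succ_top hkl]
    refine (ih.mul (h (a + l))).congr_deriv ?_
    push_cast
    rw [← add_assoc]
    ring

/-- the flow `∂_t u_{0,0} = u_{0,0}(S-1)∏_{k=0}^{N} S^{k-N-1}(1/(Q_{(N+1,0)}-α))`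
is a generalized symmetry of the equation `Q_{(N,1)} + α = 0`. -/
theorem symmetry_of_QN1 (N : ℕ) (hN : 1 ≤ N) (α : ℝ) (u : ℝ → ℤ → ℤ → ℝ)
    (hne : ∀ (t : ℝ) (n m : ℤ), Qp (u t) (N + 1) 0 n m - α ≠ 0)
    (G : ℝ → ℤ → ℤ → ℝ)
    (hG : ∀ (t : ℝ) (n m : ℤ),
      G t n m = ∏ k ∈ Finset.range (N + 1),
        (Qp (u t) (N + 1) 0 (n + (k : ℤ) - (N : ℤ) - 1) m - α)⁻¹)
    (hflow : ∀ (n m : ℤ) (t : ℝ),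
      HasDerivAt (fun s => u s n m) (u t n m * (G t (n + 1) m - G t n m)) t)
    (t₀ : ℝ)
    (hsol : ∀ n m : ℤ, Qp (u t₀) N 1 n m + α = 0) :
    ∀ n m : ℤ, HasDerivAt (fun s => Qp (u s) N 1 n m) 0 t₀ := by
  intro n m
  set x : ℤ → ℝ := fun a => u t₀ a m with hxdef
  set y : ℤ → ℝ := fun a => u t₀ a (m + 1) with hydef
  have hsum : ∀ a, ∑ k ∈ Finset.range (N + 1), pathWeight x y N a k = -α := by
    intro a
    rw [← Qp_one_right]
    linarith [hsol a m]
  have hQ : ∀ a b, Qp (u t₀) (N + 1) 0 a b - α =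
      ∏ j ∈ Finset.Ico 0 (N + 2), u t₀ (a + (j : ℤ)) b - α := fun a b => by rw [Qp_zero_right]
  have hrel := row_relation hsum
  have hne₀ : ∀ a, x a ≠ 0 ∧ y a ≠ 0 := by
    by_cases hα : α = 0
    · subst hα
      intro a
      have aux : ∀ b, u t₀ a b ≠ 0 := by
        intro b hb
        apply hne t₀ a b
        rw [hQ, prod_Ico_zero_succ_shift (fun a => u t₀ a b), hb]
        simp
      exact ⟨aux m, aux (m + 1)⟩
    · exact ne_zero_of_sum_pathWeight hsum hα
  have key := sum_pathWeight_mul_sub (X := fun a => G t₀ a m) (Y := fun a => G t₀ a (m + 1))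
    (fun a => (hne₀ a).1) (fun a => (hne₀ a).2)
    (fun a => hne t₀ a m) (fun a => hne t₀ a (m + 1)) (fun a => hQ a m) (fun a => hQ a (m + 1))
    (fun a => by rw [hQ, hQ]; exact hrel a) (fun a => hG t₀ a m) (fun a => hG t₀ a (m + 1)) n
  simp only [Qp_one_right]
  have hder : ∀ k ∈ Finset.range (N + 1), HasDerivAt
      (fun s => pathWeight (fun a => u s a m) (fun a => u s a (m + 1)) N n k)
      (pathWeight x y N n k * (G t₀ (n + (k : ℤ) + 1) m - G t₀ (n + (k : ℤ)) (m + 1))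
        + pathWeight x y N n k * (G t₀ (n + (N : ℤ) + 1) (m + 1) - G t₀ n m)) t₀ := by
    intro k hk
    have hk : k ≤ N + 1 := (Finset.mem_range.mp hk).le
    have h1 := hasDerivAt_prod_Ico (v := fun s a => u s a m) (g := fun a => G t₀ a m)
      (fun a => hflow a m t₀) n (Nat.zero_le (k + 1))
    have h2 := hasDerivAt_prod_Ico (v := fun s a => u s a (m + 1))
      (g := fun a => G t₀ a (m + 1)) (fun a => hflow a (m + 1) t₀) n hk
    refine (h1.mul h2).congr_deriv ?_
    simp only [pathWeight, hxdef, hydef]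
    push_cast
    simp only [← add_assoc, add_zero]
    ring
  refine (HasDerivAt.fun_sum hder).congr_deriv ?_
  rw [Finset.sum_add_distrib, key, ← Finset.sum_mul, hsum]
  ring
end

section
/- Let N ≥ 1, α ∈ ℝ, and u : ℝ → ℤ × ℤ → ℝ. For each t let Q^t_{(i,j)} denote the polynomials built from u(t,·,·), and assume Q^t_{(0,N+1)}(n,m) + (−1)^N·α ≠ 0 for all t, n, m. Define G(t,n,m) = ∏_{k=0}^{N} (Q^t_{(0,N+1)}(n, m+k−N−1) + (−1)^N·α)⁻¹, and suppose that for every (n,m) and every t the function t ↦ u(t,n,m) has derivative u(t,n,m)·(G(t,n,m+1) − G(t,n,m)) at t. If at some time t₀ the equation Q^{t₀}_{(1,N)}(n,m) − (−1)^N·α = 0 holds for all (n,m) ∈ ℤ², then for every (n,m) the function t ↦ Q^t_{(1,N)}(n,m) has derivative 0 at t₀. (That is, the flow ∂_s u_{0,0} = u_{0,0}(T−1)∏_{k=0}^{N} T^{k−N−1}(1/(Q_{(0,N+1)} + (−1)^N α)) is a generalized symmetry of the equation Q_{(1,N)} − (−1)^N α = 0.) -/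
/-- The product of `f` over the `l` consecutive integers `s, s + 1, …, s + l - 1`. -/
noncomputable def windowProd (f : ℤ → ℝ) (s : ℤ) (l : ℕ) : ℝ :=
  ∏ i ∈ Finset.range l, f (s + i)

lemma windowProd_zero (f : ℤ → ℝ) (s : ℤ) : windowProd f s 0 = 1 := by
  simp [windowProd]

lemma windowProd_one (f : ℤ → ℝ) (s : ℤ) : windowProd f s 1 = f s := by
  simp [windowProd]

lemma windowProd_add (f : ℤ → ℝ) (s : ℤ) (l l' : ℕ) :
    windowProd f s (l + l') = windowProd f s l * windowProd f (s + l) l' := by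
  simp [windowProd, Finset.prod_range_add, add_assoc]

lemma windowProd_succ (f : ℤ → ℝ) (s : ℤ) (l : ℕ) :
    windowProd f s (l + 1) = windowProd f s l * f (s + l) := by
  rw [windowProd_add, windowProd_one]

lemma windowProd_succ_left (f : ℤ → ℝ) (s : ℤ) (l : ℕ) :
    windowProd f s (l + 1) = f s * windowProd f (s + 1) l := by
  rw [add_comm l 1, windowProd_add, windowProd_one, Nat.cast_one]

/-- A pointwise relation between products of two functions passes to windows. -/
lemma windowProd_mul_eq {a b x y : ℤ → ℝ} {d : ℤ} (h : ∀ i, a i * x i = b (i + d) * y i)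
    (s : ℤ) (l : ℕ) :
    windowProd a s l * windowProd x s l = windowProd b (s + d) l * windowProd y s l := by
  simp only [windowProd, ← Finset.prod_mul_distrib]
  exact Finset.prod_congr rfl fun i _ => by rw [h, add_right_comm]

/-- Along a flow of the form `f' = f (T - 1) g`, logarithmic derivatives telescope on windows. -/
lemma hasDerivAt_windowProd {f : ℝ → ℤ → ℝ} {g : ℤ → ℝ} {t : ℝ}
    (h : ∀ i, HasDerivAt (fun s => f s i) (f t i * (g (i + 1) - g i)) t) (m : ℤ) (l : ℕ) :
    HasDerivAt (fun s => windowProd (f s) m l)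
      (windowProd (f t) m l * (g (m + l) - g m)) t := by
  induction l with
  | zero => simpa [windowProd_zero] using hasDerivAt_const t (1 : ℝ)
  | succ l ih =>
    simp only [windowProd_succ]
    refine (ih.fun_mul (h (m + l))).congr_deriv ?_
    push_cast
    rw [← add_assoc]
    ring

lemma Qp_zero_left (u : ℤ → ℤ → ℝ) (j : ℕ) (n m : ℤ) :
    Qp u 0 j n m = windowProd (u n) m (j + 1) := by
  induction j with
  | zero => simp [Qp, windowProd_one]
  | succ j ih => rw [Qp, ih, windowProd_succ _ _ (j + 1)]

lemma Qp_one_zero (u : ℤ → ℤ → ℝ) (n m : ℤ) : Qp u 1 0 n m = u n m * u (n + 1) m := by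
  simp [Qp]

lemma Qp_one_succ (u : ℤ → ℤ → ℝ) (j : ℕ) (n m : ℤ) :
    Qp u 1 (j + 1) n m =
      (Qp u 1 j n m + windowProd (u n) m (j + 2)) * u (n + 1) (m + (j + 1 : ℕ)) := by
  rw [Qp, Qp_zero_left]
  simp

/-- Splitting off the first step of the lattice paths instead of the last one. -/
lemma Qp_one_succ_left (u : ℤ → ℤ → ℝ) (j : ℕ) (n m : ℤ) :
    Qp u 1 (j + 1) n m =
      u n m * (windowProd (u (n + 1)) m (j + 2) + Qp u 1 j n (m + 1)) := by
  induction j with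
  | zero =>
    simp only [Qp_one_succ, Qp_one_zero, windowProd_succ, windowProd_zero]
    push_cast
    simp only [add_zero]
    ring
  | succ j ih =>
    rw [Qp_one_succ, ih, Qp_one_succ u j n (m + 1), windowProd_succ_left (u n),
      windowProd_succ (u (n + 1)) m (j + 2)]
    have e : m + 1 + ((j + 1 : ℕ) : ℤ) = m + ((j + 1 + 1 : ℕ) : ℤ) := by push_cast; ring
    rw [e]
    ring

/-- The expansion of `Q_{(1,j)}` over the height `k` at which a lattice path moves to the right. -/
lemma Qp_one_eq_sum (u : ℤ → ℤ → ℝ) (j : ℕ) (n m : ℤ) :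
    Qp u 1 j n m = ∑ k ∈ Finset.range (j + 1),
      windowProd (u n) m (k + 1) * windowProd (u (n + 1)) (m + k) (j + 1 - k) := by
  induction j with
  | zero => simp [Qp_one_zero, windowProd_one]
  | succ j ih =>
    rw [Qp_one_succ, ih, Finset.sum_range_succ _ (j + 1), add_mul, Finset.sum_mul,
      Nat.add_sub_cancel_left, windowProd_one]
    congr 1
    refine Finset.sum_congr rfl fun k hk => ?_
    obtain ⟨r, rfl⟩ := Nat.exists_eq_add_of_le (Nat.lt_succ_iff.mp (Finset.mem_range.mp hk))
    rw [show k + r + 1 + 1 - k = (r + 1) + 1 by omega, show k + r + 1 - k = r + 1 by omega,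
      windowProd_succ _ _ (r + 1), mul_assoc]
    congr 3
    push_cast
    ring

/-- The telescoping identity behind the symmetry: the mixed windows
`x_{k-N-1} ⋯ x_{-1} y_0 ⋯ y_{k-1}` interpolate between the two sides of the sum. -/
lemma sum_windowProd_mul_sub {a b x y : ℤ → ℝ} {c : ℝ} {N : ℕ}
    (hx : ∀ i, (windowProd a i (N + 2) + c) * x i = 1)
    (hy : ∀ i, (windowProd b i (N + 2) + c) * y i = 1)
    (h : ∀ i, a i * x i = b (i + (N + 1 : ℕ)) * y i) (m : ℤ) :
    ∑ k ∈ Finset.range (N + 1),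
        windowProd a m (k + 1) * windowProd b (m + k) (N + 1 - k) *
          (windowProd x (m + k - N) (N + 1) - windowProd y (m + k - N - 1) (N + 1)) =
      c * (windowProd x (m - N - 1) (N + 1) - windowProd y m (N + 1)) := by
  let M : ℕ → ℝ := fun k => windowProd x (m + k - N - 1) (N + 1 - k) * windowProd y m k
  have hM : windowProd x (m - N - 1) (N + 1) - windowProd y m (N + 1) = M 0 - M (N + 1) := by
    simp [M, windowProd_zero]
  rw [hM, ← Finset.sum_range_sub', Finset.mul_sum]
  refine Finset.sum_congr rfl fun k hk => ?_
  obtain ⟨r, rfl⟩ := Nat.exists_eq_add_of_le (Nat.lt_succ_iff.mp (Finset.mem_range.mp hk))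
  have hB : windowProd b (m + k) (k + r + 2) =
      windowProd b (m + k) (r + 1) * windowProd b (m + (k + r + 1 : ℕ)) (k + 1) := by
    rw [show k + r + 2 = (r + 1) + (k + 1) by omega, windowProd_add]
    congr 2; push_cast; ring
  have hA : windowProd a (m - r - 1) (k + r + 2) =
      windowProd a (m - r - 1) (r + 1) * windowProd a m (k + 1) := by
    rw [show k + r + 2 = (r + 1) + (k + 1) by omega, windowProd_add]
    congr 2; push_cast; ring
  have hX : windowProd x (m + k - (k + r : ℕ)) (k + r + 1) =
      windowProd x (m - r) r * windowProd x m (k + 1) := by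
    rw [show m + k - (k + r : ℕ) = m - r by push_cast; ring,
      show k + r + 1 = r + (k + 1) by omega, windowProd_add, sub_add_cancel]
  have hY : windowProd y (m + k - (k + r : ℕ) - 1) (k + r + 1) =
      windowProd y (m - r - 1) (r + 1) * windowProd y m k := by
    rw [show m + k - (k + r : ℕ) - 1 = m - r - 1 by push_cast; ring,
      show k + r + 1 = (r + 1) + k by omega, windowProd_add]
    congr 2; push_cast; ring
  have hM₀ : M k = x (m - r - 1) * windowProd x (m - r) r * windowProd y m k := by
    simp only [M]
    rw [show k + r + 1 - k = r + 1 by omega, windowProd_succ_left]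
    congr 3
    · push_cast; ring
    · push_cast; ring
  have hM₁ : M (k + 1) = windowProd x (m - r) r * (windowProd y m k * y (m + k)) := by
    simp only [M]
    rw [show k + r + 1 - (k + 1) = r by omega, windowProd_succ]
    congr 2
    push_cast; ring
  have h₁ := windowProd_mul_eq h m (k + 1)
  have h₂ := windowProd_mul_eq h (m - r - 1) (r + 1)
  rw [show m - r - 1 + ((k + r + 1 : ℕ) : ℤ) = m + k by push_cast; ring] at h₂
  have hxr := hx (m - r - 1)
  have hyk := hy (m + k)
  rw [hA] at hxr
  rw [hB] at hyk
  rw [windowProd_succ y m k] at h₁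
  rw [windowProd_succ_left x (m - r - 1) r, show m - (r : ℤ) - 1 + 1 = m - r by ring] at h₂
  rw [show k + r + 1 - k = r + 1 by omega, hX, hY, hM₀, hM₁]
  linear_combination
    windowProd b (m + k) (r + 1) * windowProd x (m - r) r * h₁
      + windowProd a m (k + 1) * windowProd y m k * h₂
      + windowProd x (m - r) r * windowProd y m k * (hyk - hxr)

/-- the flow `∂_s u_{0,0} = u_{0,0}(T-1)∏_{k=0}^{N} T^{k-N-1}(1/(Q_{(0,N+1)}+(-1)^N α))`
is a generalized symmetry of the equation `Q_{(1,N)} - (-1)^N α = 0`. -/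
theorem symmetry_of_Q1N (N : ℕ) (hN : 1 ≤ N) (α : ℝ) (u : ℝ → ℤ → ℤ → ℝ)
    (hne : ∀ (t : ℝ) (n m : ℤ), Qp (u t) 0 (N + 1) n m + (-1 : ℝ) ^ N * α ≠ 0)
    (G : ℝ → ℤ → ℤ → ℝ)
    (hG : ∀ (t : ℝ) (n m : ℤ),
      G t n m = ∏ k ∈ Finset.range (N + 1),
        (Qp (u t) 0 (N + 1) n (m + (k : ℤ) - (N : ℤ) - 1) + (-1 : ℝ) ^ N * α)⁻¹)
    (hflow : ∀ (n m : ℤ) (t : ℝ),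
      HasDerivAt (fun s => u s n m) (u t n m * (G t n (m + 1) - G t n m)) t)
    (t₀ : ℝ)
    (hsol : ∀ n m : ℤ, Qp (u t₀) 1 N n m - (-1 : ℝ) ^ N * α = 0) :
    ∀ n m : ℤ, HasDerivAt (fun s => Qp (u s) 1 N n m) 0 t₀ := by
  intro n m
  set c : ℝ := (-1 : ℝ) ^ N * α
  let x : ℤ → ℤ → ℝ := fun n i => (windowProd (u t₀ n) i (N + 2) + c)⁻¹
  have hne' : ∀ n i, windowProd (u t₀ n) i (N + 2) + c ≠ 0 := fun n i => by
    simpa only [Qp_zero_left] using hne t₀ n i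
  have hx : ∀ n i, (windowProd (u t₀ n) i (N + 2) + c) * x n i = 1 := fun n i =>
    mul_inv_cancel₀ (hne' n i)
  have hGx : ∀ n i, G t₀ n i = windowProd (x n) (i - N - 1) (N + 1) := fun n i => by
    rw [hG]
    refine Finset.prod_congr rfl fun k _ => ?_
    simp only [x, Qp_zero_left]
    rw [show i + (k : ℤ) - N - 1 = i - N - 1 + k by ring]
  have hrel : ∀ i, u t₀ n i * x n i = u t₀ (n + 1) (i + (N + 1 : ℕ)) * x (n + 1) i := fun i => by
    have h := (Qp_one_succ (u t₀) N n i).symm.trans (Qp_one_succ_left (u t₀) N n i)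
    rw [sub_eq_zero.mp (hsol n i), sub_eq_zero.mp (hsol n (i + 1))] at h
    linear_combination -x n i * x (n + 1) i * h
      + u t₀ (n + 1) (i + (N + 1 : ℕ)) * x (n + 1) i * hx n i
      - u t₀ n i * x n i * hx (n + 1) i
  have hsum := sum_windowProd_mul_sub (hx n) (hx (n + 1)) hrel m
  have hQ := sub_eq_zero.mp (hsol n m)
  simp only [Qp_one_eq_sum] at hQ ⊢
  refine (HasDerivAt.fun_sum fun k _ =>
    (hasDerivAt_windowProd (fun i => hflow n i t₀) m (k + 1)).fun_mul
      (hasDerivAt_windowProd (fun i => hflow (n + 1) i t₀) (m + k) (N + 1 - k))).congr_deriv ?_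
  rw [← hQ, Finset.sum_mul, ← sub_eq_zero, ← Finset.sum_sub_distrib] at hsum
  rw [← hsum]
  refine Finset.sum_congr rfl fun k hk => ?_
  have hk' : k ≤ N + 1 := (Finset.mem_range.mp hk).le
  rw [hGx, hGx, hGx, hGx, show m + ((k + 1 : ℕ) : ℤ) - N - 1 = m + k - N by push_cast; ring,
    show m + (k : ℤ) + ((N + 1 - k : ℕ) : ℤ) - N - 1 = m by push_cast [Nat.cast_sub hk']; ring]
  ring
end

section
/- Let N ≥ 1, α ∈ ℝ with α ≠ 0, and u : ℝ → ℤ × ℤ → ℝ. Assume Q^t_{(N+1,0)}(n,m) − α ≠ 0 for all t, n, m, define G(t,n,m) = ∏_{k=0}^{N} (Q^t_{(N+1,0)}(n+k−N−1, m) − α)⁻¹, and suppose that for every (n,m) and every t the function t ↦ u(t,n,m) has derivative u(t,n,m)·(G(t,n+1,m) − G(t,n,m)) at t. If at some time t₀ all equations of Σ_N hold, i.e. Q^{t₀}_{(i,N+1−i)}(n,m) + (−1)^{N−i}·α = 0 for every i with 1 ≤ i ≤ N and all (n,m), then for every i with 1 ≤ i ≤ N and every (n,m) the function t ↦ Q^t_{(i,N+1−i)}(n,m)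 has derivative 0 at t₀. (The lowest order symmetry in the first direction of the scalar equation Q_{(N,1)} + α = 0 extends to a symmetry of the full consistent system Σ_N.) -/
section PathPolynomials

variable (u : ℤ → ℤ → ℝ)

lemma Qp_zero_zero (n m : ℤ) : Qp u 0 0 n m = u n m := by
  simp [Qp]

lemma Qp_succ_zero (i : ℕ) (n m : ℤ) :
    Qp u (i + 1) 0 n m = Qp u i 0 n m * u (n + i + 1) m := by
  simp [Qp, add_assoc]

lemma Qp_zero_succ (j : ℕ) (n m : ℤ) :
    Qp u 0 (j + 1) n m = Qp u 0 j n m * u n (m + j + 1) := by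
  simp [Qp, add_assoc]

lemma Qp_succ_succ (i j : ℕ) (n m : ℤ) :
    Qp u (i + 1) (j + 1) n m =
      (Qp u (i + 1) j n m + Qp u i (j + 1) n m) * u (n + i + 1) (m + j + 1) := by
  simp [Qp, add_assoc]

/-- Splitting off the first vertex of a horizontal path. -/
lemma Qp_succ_zero_left (i : ℕ) (n m : ℤ) :
    Qp u (i + 1) 0 n m = u n m * Qp u i 0 (n + 1) m := by
  induction i with
  | zero => simp [Qp]
  | succ i ih =>
    rw [Qp_succ_zero, ih, Qp_succ_zero]
    push_cast
    rw [show n + ((i : ℤ) + 1) + 1 = n + 1 + i + 1 by ring]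
    ring

/-- Splitting off the first vertex of a vertical path. -/
lemma Qp_zero_succ_left (j : ℕ) (n m : ℤ) :
    Qp u 0 (j + 1) n m = u n m * Qp u 0 j n (m + 1) := by
  induction j with
  | zero => simp [Qp]
  | succ j ih =>
    rw [Qp_zero_succ, ih, Qp_zero_succ]
    push_cast
    rw [show m + ((j : ℤ) + 1) + 1 = m + 1 + j + 1 by ring]
    ring

/-- Splitting off the first vertex of a lattice path. -/
lemma Qp_succ_succ_left (i j : ℕ) (n m : ℤ) :
    Qp u (i + 1) (j + 1) n m =
      u n m * (Qp u i (j + 1) (n + 1) m + Qp u (i + 1) j n (m + 1)) := by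
  have hn (k : ℕ) : n + ((k + 1 : ℕ) : ℤ) + 1 = n + 1 + k + 1 := by push_cast; ring
  have hm (k : ℕ) : m + ((k + 1 : ℕ) : ℤ) + 1 = m + 1 + k + 1 := by push_cast; ring
  induction i generalizing j with
  | zero =>
    induction j with
    | zero => simp [Qp]; ring
    | succ j ih =>
      rw [Qp_succ_succ, ih, Qp_zero_succ_left u (j + 1) n m, Qp_succ_succ u 0 j n,
        Qp_zero_succ u (j + 1) (n + 1), hm]
      simp only [Nat.cast_zero, add_zero]
      ring
  | succ i ih =>
    induction j with
    | zero =>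
      rw [Qp_succ_succ, ih, Qp_succ_zero_left u (i + 1) n m, Qp_succ_succ u i 0 (n + 1),
        Qp_succ_zero u (i + 1) n (m + 1), hn]
      simp only [Nat.cast_zero, add_zero]
      ring
    | succ j ihj =>
      rw [Qp_succ_succ, ih, ihj, Qp_succ_succ u i (j + 1), Qp_succ_succ u (i + 1) j, hn, hm]
      ring

lemma Qp_neg (i j : ℕ) (n m : ℤ) :
    Qp (fun a b => u (-a) (-b)) i j (-(n + i)) (-(m + j)) = Qp u i j n m := by
  induction i generalizing j n m with
  | zero =>
    induction j generalizing n m with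
    | zero => simp [Qp]
    | succ j ih =>
      rw [Qp_zero_succ, Qp_zero_succ_left, ← ih, mul_comm]
      push_cast
      congr 2 <;> ring_nf
  | succ i ihi =>
    induction j generalizing n m with
    | zero =>
      rw [Qp_succ_zero, Qp_succ_zero_left, ← ihi, mul_comm]
      push_cast
      congr 2 <;> ring_nf
    | succ j ih =>
      rw [Qp_succ_succ, Qp_succ_succ_left, ← ihi, ← ih, mul_comm, add_comm (Qp _ _ _ _ _)]
      push_cast
      congr 2 <;> ring_nf

lemma Qp_row_eq_prod (i : ℕ) (n m : ℤ) :
    Qp u i 0 n m = ∏ k ∈ Finset.range (i + 1), u (n + k) m := by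
  induction i with
  | zero => simp [Qp]
  | succ i ih =>
    rw [Qp_succ_zero, ih, Finset.prod_range_succ _ (i + 1)]
    push_cast
    rw [add_assoc n]

variable {u} in
lemma Qp_row_ne_zero (hu : ∀ n m, u n m ≠ 0) (i : ℕ) (n m : ℤ) : Qp u i 0 n m ≠ 0 := by
  rw [Qp_row_eq_prod]
  exact Finset.prod_ne_zero_iff.mpr fun _ _ => hu _ _

end PathPolynomials

section WeightedSums

/-- The sum `∑ₖ αᵏ Q_{(i,j-k)}(n,m+k) / ∏_{l=1}^k Q_{(N,0)}(n,m+l)`. -/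
noncomputable def columnSum (N : ℕ) (α : ℝ) (u : ℤ → ℤ → ℝ) (i : ℕ) : ℕ → ℤ → ℤ → ℝ
  | 0, n, m => Qp u i 0 n m
  | j + 1, n, m => Qp u i (j + 1) n m + α / Qp u N 0 n (m + 1) * columnSum N α u i j n (m + 1)

variable {N : ℕ} {α : ℝ} {u : ℤ → ℤ → ℝ}

lemma columnSum_succ (i j : ℕ) (n m : ℤ) :
    columnSum N α u i (j + 1) n m =
      Qp u i (j + 1) n m + α / Qp u N 0 n (m + 1) * columnSum N α u i j n (m + 1) := rfl

lemma columnSum_succ_succ (i j : ℕ) (n m : ℤ) :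
    columnSum N α u (i + 1) (j + 1) n m =
      (columnSum N α u (i + 1) j n m + columnSum N α u i (j + 1) n m) *
        u (n + i + 1) (m + j + 1) := by
  induction j generalizing m with
  | zero =>
    simp only [columnSum, Qp_succ_succ u i 0, Qp_succ_zero u i, Nat.cast_zero, add_zero]
    ring
  | succ j ih =>
    rw [columnSum_succ _ (j + 1), ih, columnSum_succ (i + 1) j, columnSum_succ i (j + 1),
      Qp_succ_succ u i (j + 1)]
    push_cast
    rw [show m + ((j : ℤ) + 1) + 1 = m + 1 + j + 1 by ring]
    ring

/-- On solutions of the system the column sums on the antidiagonal `i + j = N + 1` vanish. -/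
lemma columnSum_eq_zero (hu : ∀ n m, u n m ≠ 0)
    (hsol : ∀ i j : ℕ, i + j = N → 1 ≤ i → ∀ n m, Qp u i (j + 1) n m = -((-1) ^ j * α))
    (i j : ℕ) (hij : i + j = N) (hi : 1 ≤ i) (n m : ℤ) :
    columnSum N α u i (j + 1) n m = 0 := by
  have of_eq : ∀ i j : ℕ, i + j = N → 1 ≤ i →
      (∀ m, columnSum N α u i j n m = (-1) ^ j * Qp u N 0 n m) →
      ∀ m, columnSum N α u i (j + 1) n m = 0 := by
    intro i j hij hi h m
    have hp := Qp_row_ne_zero hu N n (m + 1)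
    rw [columnSum, h, hsol i j hij hi]
    field_simp
    ring
  refine of_eq i j hij hi ?_ m
  induction j generalizing i with
  | zero =>
    intro m
    obtain rfl : i = N := by omega
    simp [columnSum]
  | succ j ih =>
    intro m
    have hz := of_eq (i + 1) j (by omega) (by omega) (ih (i + 1) (by omega) (by omega)) m
    rw [columnSum_succ_succ, ih (i + 1) (by omega) (by omega)] at hz
    have := (mul_eq_zero.mp hz).resolve_right (hu _ _)
    rw [pow_succ]
    linear_combination this

/-- The weights `g(n,m) / ∏_{l=1}^j p(n,m+l)`. -/
noncomputable def weight (p g : ℤ → ℤ → ℝ) : ℕ → ℤ → ℤ → ℝ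
  | 0, n, m => g n m
  | j + 1, n, m => weight p g j n m / p n (m + j + 1)

/-- The weighted sum `∑ₖ αᵏ Z (j + k) (r - k) q (r - k)`. -/
noncomputable def diagonalSum (α : ℝ) (Z : ℕ → ℕ → ℝ) (q : ℕ → ℝ) : ℕ → ℕ → ℝ
  | j, 0 => Z j 0 * q 0
  | j, r + 1 => Z j (r + 1) * q (r + 1) + α * diagonalSum α Z q (j + 1) r

lemma diagonalSum_succ_right (Z : ℕ → ℕ → ℝ) (q : ℕ → ℝ) (j r : ℕ) :
    diagonalSum α Z q j (r + 1) =
      Z j (r + 1) * q (r + 1) + α * diagonalSum α Z q (j + 1) r := rfl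

lemma diagonalSum_succ {Y Z : ℕ → ℕ → ℝ} {v q s : ℕ → ℝ}
    (hYZ : ∀ j l, v l * v (l + j + 1) * (Z j l - Y j (l + 1)) =
      α * (v l * Z (j + 1) l - v (l + j + 1) * Y (j + 1) l))
    (hq0 : q 0 = s 0 * v 0) (hq : ∀ r, q (r + 1) = (q r + s (r + 1)) * v (r + 1)) (j r : ℕ) :
    diagonalSum α Z q j (r + 1) =
      (diagonalSum α Z q j r + diagonalSum α Y s j (r + 1)) * v (r + j + 1)
        + q (r + 1) * Z j (r + 1) - v (r + j + 1) * (q r + s (r + 1)) * Y j (r + 1) := by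
  induction r generalizing j with
  | zero =>
    have h := hYZ j 0
    simp only [diagonalSum, zero_add] at h ⊢
    rw [hq0]
    linear_combination (-s 0) * h
  | succ r ih =>
    have h := hYZ j (r + 1)
    rw [diagonalSum_succ_right Z q j (r + 1), ih, diagonalSum_succ_right Z q j r,
      diagonalSum_succ_right Y s j (r + 1),
      show r + (j + 1) + 1 = r + 1 + j + 1 by ring]
    linear_combination (-(q r + s (r + 1))) * h + (α * Z (j + 1) (r + 1) -
      v (r + 1 + j + 1) * Z j (r + 1) + v (r + 1 + j + 1) * Y j (r + 1 + 1)) * hq r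

lemma diagonalSum_ite (Y : ℕ → ℕ → ℝ) (j r : ℕ) :
    diagonalSum α Y (fun l => if l = 0 then 1 else 0) j r = α ^ r * Y (j + r) 0 := by
  induction r generalizing j with
  | zero => simp [diagonalSum]
  | succ r ih =>
    rw [diagonalSum, ih, show j + 1 + r = j + (r + 1) by ring, pow_succ]
    simp
    ring

lemma weight_mul_columnSum_zero_succ (g : ℤ → ℤ → ℝ) (j r : ℕ) (n m : ℤ) :
    weight (Qp u N 0) g j n m * columnSum N α u 0 (r + 1) n (m + j) =
      (weight (Qp u N 0) g j n m * columnSum N α u 0 r n (m + j)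
        + α ^ (r + 1) * weight (Qp u N 0) g (j + r + 1) n m) * u n (m + j + r + 1) := by
  induction r generalizing j with
  | zero =>
    simp only [columnSum, Qp_zero_succ, Qp_zero_zero, weight, Nat.cast_zero, add_zero]
    ring
  | succ r ih =>
    have h := ih (j + 1)
    rw [columnSum_succ 0 (r + 1), columnSum_succ 0 r n (m + j), Qp_zero_succ u (r + 1)]
    rw [weight, show j + 1 + r + 1 = j + (r + 1) + 1 by ring] at h
    push_cast at h ⊢
    rw [show m + ((j : ℤ) + 1) + r + 1 = m + j + (r + 1) + 1 by ring,
      show m + ((j : ℤ) + 1) = m + j + 1 by ring] at h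
    linear_combination α * h

end WeightedSums

section Symmetry

variable {N : ℕ} {α : ℝ} {u g : ℤ → ℤ → ℝ}

/-- The shift of `Q_{(N+1,0)} - α` in the second direction on solutions of `Q_{(N,1)} + α = 0`. -/
lemma Qp_row_sub_shift (h : ∀ n m, Qp u N 1 n m = -α) (n m : ℤ) :
    u n m * (Qp u (N + 1) 0 n (m + 1) - α) =
      (Qp u (N + 1) 0 n m - α) * u (n + N + 1) (m + 1) := by
  have h₁ := Qp_succ_succ u N 0 n m
  have h₂ := Qp_succ_succ_left u N 0 n m
  simp only [zero_add, h, Nat.cast_zero, add_zero] at h₁ h₂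
  linear_combination h₁ - h₂

lemma weight_succ_eq_shift
    (hg : ∀ n m, g n (m + 1) / Qp u N 0 (n - N - 1) m = g n m / Qp u N 0 n (m + 1))
    (j : ℕ) (n m : ℤ) :
    weight (Qp u N 0) g (j + 1) n m =
      weight (Qp u N 0) g j n (m + 1) / Qp u N 0 (n - N - 1) m := by
  induction j with
  | zero => simp [weight, hg]
  | succ j ih =>
    rw [weight, ih, weight]
    push_cast
    rw [show m + ((j : ℤ) + 1) + 1 = m + 1 + j + 1 by ring, div_right_comm]

lemma weight_shift (hu : ∀ n m, u n m ≠ 0) (h : ∀ n m, Qp u N 1 n m = -α)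
    (hg : ∀ n m, g (n + 1) m * (Qp u (N + 1) 0 n m - α) =
      g n m * (Qp u (N + 1) 0 (n - N - 1) m - α)) (j : ℕ) (n m : ℤ) :
    u n m * weight (Qp u N 0) g j (n + 1) m * (Qp u (N + 1) 0 n (m + j) - α) =
      u n (m + j) * weight (Qp u N 0) g j n m * (Qp u (N + 1) 0 (n - N - 1) m - α) := by
  induction j with
  | zero =>
    simp only [weight, Nat.cast_zero, add_zero]
    linear_combination u n m * hg n m
  | succ j ih =>
    have hA := Qp_row_sub_shift h n (m + j)
    have h₁ := Qp_succ_zero u N n (m + j + 1)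
    have h₂ := Qp_succ_zero_left u N n (m + j + 1)
    have hp := Qp_row_ne_zero hu N n (m + j + 1)
    have hp' := Qp_row_ne_zero hu N (n + 1) (m + j + 1)
    have hu' := hu n (m + j)
    simp only [weight]
    push_cast
    rw [← add_assoc m]
    field_simp
    rw [h₁] at h₂
    refine mul_left_cancel₀ hu' ?_
    linear_combination
      (u n m * weight (Qp u N 0) g j (n + 1) m * Qp u N 0 n (m + j + 1)) * hA +
      (Qp u N 0 n (m + j + 1) * u (n + N + 1) (m + j + 1)) * ih +
      (u n (m + j) * weight (Qp u N 0) g j n m * (Qp u (N + 1) 0 (n - N - 1) m - α)) * h₂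

lemma weight_exchange (hu : ∀ n m, u n m ≠ 0) (h : ∀ n m, Qp u N 1 n m = -α)
    (hg₁ : ∀ n m, g (n + 1) m * (Qp u (N + 1) 0 n m - α) =
      g n m * (Qp u (N + 1) 0 (n - N - 1) m - α))
    (hg₂ : ∀ n m, g n (m + 1) / Qp u N 0 (n - N - 1) m = g n m / Qp u N 0 n (m + 1))
    (j : ℕ) (n m : ℤ) :
    u n m * u n (m + j + 1) *
        (weight (Qp u N 0) g j (n + 1) m - weight (Qp u N 0) g j n (m + 1)) =
      α * (u n m * weight (Qp u N 0) g (j + 1) (n + 1) m -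
        u n (m + j + 1) * weight (Qp u N 0) g (j + 1) n m) := by
  have hs := weight_shift hu h hg₁ (j + 1) n m
  push_cast at hs
  rw [← add_assoc m] at hs
  have e₁ : weight (Qp u N 0) g j (n + 1) m =
      weight (Qp u N 0) g (j + 1) (n + 1) m * Qp u N 0 (n + 1) (m + j + 1) := by
    rw [weight, div_mul_cancel₀ _ (Qp_row_ne_zero hu _ _ _)]
  have e₂ : weight (Qp u N 0) g j n (m + 1) =
      weight (Qp u N 0) g (j + 1) n m * Qp u N 0 (n - N - 1) m := by
    rw [weight_succ_eq_shift hg₂, div_mul_cancel₀ _ (Qp_row_ne_zero hu _ _ _)]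
  have h₁ := Qp_succ_zero_left u N n (m + j + 1)
  have h₂ := Qp_succ_zero u N (n - N - 1) m
  rw [show n - N - 1 + N + 1 = n by ring] at h₂
  rw [e₁, e₂]
  linear_combination hs - (u n m * weight (Qp u N 0) g (j + 1) (n + 1) m) * h₁ +
    (u n (m + j + 1) * weight (Qp u N 0) g (j + 1) n m) * h₂

/-- The weighted diagonal sum factors through the column sum of the reflected field. -/
lemma diagonalSum_eq_columnSum_neg
    (hg : ∀ n m, g n (m + 1) / Qp u N 0 (n - N - 1) m = g n m / Qp u N 0 n (m + 1))
    (i j r : ℕ) (n m : ℤ) :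
    diagonalSum α (fun k l => weight (Qp u N 0) g k (n + i + 1) (m + l))
        (fun l => Qp u i l n m) j r =
      weight (Qp u N 0) g j (n + i + 1) (m + r) *
        columnSum N α (fun a b => u (-a) (-b)) i r (-(n + i)) (-(m + r)) := by
  induction r generalizing j with
  | zero =>
    have h := Qp_neg u i 0 n m
    rw [diagonalSum, columnSum, h]
  | succ r ih =>
    have h := Qp_neg u N 0 (n + i - N) (m + r)
    rw [diagonalSum, columnSum, Qp_neg, ih, weight_succ_eq_shift hg]
    push_cast at h ⊢
    rw [show -(n + i - N + N : ℤ) = -(n + i) by ring, add_zero] at h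
    rw [show -(m + ((r : ℤ) + 1)) + 1 = -(m + r) by ring, h,
      show n + i + 1 - N - 1 = n + i - (N : ℤ) by ring, ← add_assoc m]
    ring

/-- Time derivative of the path polynomials along the flow. -/
lemma hasDerivAt_Qp {u : ℝ → ℤ → ℤ → ℝ} {t : ℝ} (hu : ∀ n m, u t n m ≠ 0)
    (h : ∀ n m, Qp (u t) N 1 n m = -α)
    (hg₁ : ∀ n m, g (n + 1) m * (Qp (u t) (N + 1) 0 n m - α) =
      g n m * (Qp (u t) (N + 1) 0 (n - N - 1) m - α))
    (hg₂ : ∀ n m, g n (m + 1) / Qp (u t) N 0 (n - N - 1) m = g n m / Qp (u t) N 0 n (m + 1))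
    (hflow : ∀ n m, HasDerivAt (fun s => u s n m) (u t n m * (g (n + 1) m - g n m)) t)
    (i r : ℕ) (n m : ℤ) :
    HasDerivAt (fun s => Qp (u s) i r n m)
      (diagonalSum α (fun k l => weight (Qp (u t) N 0) g k (n + i + 1) (m + l))
        (fun l => Qp (u t) i l n m) 0 r - g n m * columnSum N α (u t) i r n m) t := by
  have hexch (x : ℤ) (j l : ℕ) := weight_exchange hu h hg₁ hg₂ j x (m + l)
  induction i generalizing r with
  | zero =>
    induction r with
    | zero =>
      simp only [Qp_zero_zero, diagonalSum, columnSum, weight]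
      refine (hflow n m).congr_deriv ?_
      simp only [Nat.cast_zero, add_zero]
      ring
    | succ r ih =>
      simp only [Qp_zero_succ (u _) r]
      refine (ih.mul (hflow n (m + r + 1))).congr_deriv ?_
      rw [diagonalSum_succ (Y := fun k l => weight (Qp (u t) N 0) g k n (m + l))
        (v := fun l => u t n (m + l)) (s := fun l => if l = 0 then 1 else 0)
        (fun j l => ?_) ?_ (fun l => ?_), diagonalSum_ite]
      · have hc := weight_mul_columnSum_zero_succ (N := N) (α := α) (u := u t) g 0 r n m
        simp only [Nat.cast_zero, add_zero, zero_add] at hc ⊢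
        simp only [weight] at hc ⊢
        rw [hc, Qp_zero_succ]
        push_cast
        simp only [← add_assoc]
        ring
      · simp [Qp_zero_zero]
      · simpa [add_assoc] using hexch n j l
      · simp [Qp_zero_succ, add_assoc]
  | succ i ihi =>
    induction r with
    | zero =>
      simp only [Qp_succ_zero (u _) i]
      refine ((ihi 0).mul (hflow (n + i + 1) m)).congr_deriv ?_
      simp only [diagonalSum, columnSum, weight, Qp_succ_zero]
      push_cast
      simp only [← add_assoc, add_zero]
      ring
    | succ r ih =>
      simp only [Qp_succ_succ (u _) i r]
      refine ((ih.add (ihi (r + 1))).mul (hflow (n + i + 1) (m + r + 1))).congr_deriv ?_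
      rw [diagonalSum_succ (Z := fun k l => weight _ _ k (n + (i + 1 : ℕ) + 1) _)
        (Y := fun k l => weight (Qp (u t) N 0) g k (n + i + 1) (m + l))
        (v := fun l => u t (n + i + 1) (m + l)) (s := fun l => Qp (u t) i l n m)
        (fun j l => ?_) ?_ (fun l => ?_), columnSum_succ_succ]
      · simp only [Qp_succ_succ, weight, Pi.add_apply]
        push_cast
        simp only [← add_assoc, add_zero]
        ring
      · simp [Qp_succ_zero]
      · simpa [add_assoc] using hexch (n + i + 1) j l
      · simp [Qp_succ_succ, add_assoc]

end Symmetry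

/-- the lowest order symmetry in the first direction of the scalar equation
`Q_{(N,1)} + α = 0` extends to a symmetry of the full consistent system `Σ_N`. -/
theorem symmetry_of_SigmaN (N : ℕ) (hN : 1 ≤ N) (α : ℝ) (hα : α ≠ 0)
    (u : ℝ → ℤ → ℤ → ℝ)
    (hne : ∀ (t : ℝ) (n m : ℤ), Qp (u t) (N + 1) 0 n m - α ≠ 0)
    (G : ℝ → ℤ → ℤ → ℝ)
    (hG : ∀ (t : ℝ) (n m : ℤ),
      G t n m = ∏ k ∈ Finset.range (N + 1),
        (Qp (u t) (N + 1) 0 (n + (k : ℤ) - (N : ℤ) - 1) m - α)⁻¹)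
    (hflow : ∀ (n m : ℤ) (t : ℝ),
      HasDerivAt (fun s => u s n m) (u t n m * (G t (n + 1) m - G t n m)) t)
    (t₀ : ℝ)
    (hsol : ∀ i : ℕ, 1 ≤ i → i ≤ N → ∀ n m : ℤ,
      Qp (u t₀) i (N + 1 - i) n m + (-1 : ℝ) ^ (N - i) * α = 0) :
    ∀ i : ℕ, 1 ≤ i → i ≤ N → ∀ n m : ℤ,
      HasDerivAt (fun s => Qp (u s) i (N + 1 - i) n m) 0 t₀ := by
  have hsys : ∀ i j : ℕ, i + j = N → 1 ≤ i → ∀ n m,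
      Qp (u t₀) i (j + 1) n m = -((-1) ^ j * α) := by
    intro i j hij hi n m
    have h := hsol i hi (by omega) n m
    rw [show N + 1 - i = j + 1 by omega, show N - i = j by omega] at h
    linarith
  have hQN : ∀ n m, Qp (u t₀) N 1 n m = -α := fun n m => by
    simpa using hsys N 0 rfl hN n m
  have hu : ∀ n m, u t₀ n m ≠ 0 := by
    obtain ⟨M, rfl⟩ : ∃ M, N = M + 1 := ⟨N - 1, by omega⟩
    intro n m h0
    have h := hQN n m
    rw [Qp_succ_succ_left (u t₀) M 0, h0, zero_mul] at h
    exact hα (by linarith)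
  have hp := Qp_row_ne_zero hu
  have hg₁ : ∀ n m, G t₀ (n + 1) m * (Qp (u t₀) (N + 1) 0 n m - α) =
      G t₀ n m * (Qp (u t₀) (N + 1) 0 (n - N - 1) m - α) := by
    intro n m
    rw [hG, hG, Finset.prod_range_succ, Finset.prod_range_succ']
    have h₁ := hne t₀ n m
    have h₂ := hne t₀ (n - N - 1) m
    push_cast
    rw [show n + 1 + (N : ℤ) - N - 1 = n by ring, add_zero, mul_assoc, mul_assoc,
      inv_mul_cancel₀ h₁, inv_mul_cancel₀ h₂]
    congr 1
    refine Finset.prod_congr rfl fun k _ => ?_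
    rw [show n + 1 + (k : ℤ) = n + (k + 1) by ring]
  have hg₂ : ∀ n m, G t₀ n (m + 1) / Qp (u t₀) N 0 (n - N - 1) m =
      G t₀ n m / Qp (u t₀) N 0 n (m + 1) := by
    intro n m
    rw [div_eq_div_iff (hp _ _ _) (hp _ _ _), hG, hG, Qp_row_eq_prod, Qp_row_eq_prod,
      ← Finset.prod_mul_distrib, ← Finset.prod_mul_distrib]
    refine Finset.prod_congr rfl fun k _ => ?_
    have h := Qp_row_sub_shift hQN (n + k - N - 1) m
    have h₁ := hne t₀ (n + k - N - 1) m
    have h₂ := hne t₀ (n + k - N - 1) (m + 1)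
    rw [show n + (k : ℤ) - N - 1 + N + 1 = n + k by ring] at h
    rw [show n - (N : ℤ) - 1 + k = n + k - N - 1 by ring]
    field_simp
    linear_combination -h
  intro i hi hiN n m
  obtain ⟨j, rfl⟩ : ∃ j, N = i + j := ⟨N - i, by omega⟩
  rw [show i + j + 1 - i = j + 1 by omega]
  refine (hasDerivAt_Qp hu hQN hg₁ hg₂ (fun n m => hflow n m t₀) i (j + 1) n m).congr_deriv ?_
  rw [diagonalSum_eq_columnSum_neg hg₂, columnSum_eq_zero hu hsys i j rfl hi,
    columnSum_eq_zero (fun _ _ => hu _ _) (fun a b hab ha n m => ?_) i j rfl hi]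
  · simp
  · rw [← hsys a b hab ha (-n - a) (-m - (b + 1)), ← Qp_neg]
    push_cast
    congr 1 <;> ring_nf
end

section
/- (Miura transformation to the Bogoyavlensky lattice.) Let N ≥ 1, α ∈ ℝ, and u : ℝ → ℤ × ℤ → ℝ. Assume Q^t_{(N+1,0)}(n,m) − α ≠ 0 for all t, n, m, define G(t,n,m) = ∏_{k=0}^{N} (Q^t_{(N+1,0)}(n+k−N−1, m) − α)⁻¹, and suppose that for every (n,m) and every t the function t ↦ u(t,n,m) has derivative u(t,n,m)·(G(t,n+1,m) − G(t,n,m)) at t. Define v(t,n,m) = (Q^t_{(N+1,0)}(n,m) − α)⁻¹. Then for every t, n, m the function t ↦ v(t,n,m) has derivative −v(t,n,m)·(α·v(t,n,m) + 1)·(∏_{i=1}^{N+1} v(t,n+i,m) − ∏_{i=1}^{N+1} v(t,n−i,m)) at t; that is, the substitution v = 1/(Q_{(N+1,0)} − α) maps the symmetry flow of Σ_N to the Bogoyavlensky lattice. -/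
/-- If `∂ₜ u_n = u_n (g_{n+1} - g_n)`, then the derivative of `Q_{(i,0)}` telescopes. -/
theorem hasDerivAt_Qp_zero_right {u : ℝ → ℤ → ℤ → ℝ} {g : ℤ → ℝ} {m : ℤ} {t : ℝ}
    (hu : ∀ n : ℤ, HasDerivAt (fun s => u s n m) (u t n m * (g (n + 1) - g n)) t)
    (i : ℕ) (n : ℤ) :
    HasDerivAt (fun s => Qp (u s) i 0 n m)
      (Qp (u t) i 0 n m * (g (n + i + 1) - g n)) t := by
  induction i with
  | zero => simpa [Qp] using hu n
  | succ i ih =>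
    simp only [Qp]
    refine (ih.mul (hu (n + (i + 1 : ℕ)))).congr_deriv ?_
    rw [show n + ((i + 1 : ℕ) : ℤ) = n + i + 1 by push_cast; ring]
    ring

/-- the substitution `v = 1/(Q_{(N+1,0)} - α)` maps the symmetry flow of `Σ_N`
to the Bogoyavlensky lattice
`∂_t v_{0,0} = -v_{0,0}(α v_{0,0} + 1)(v_{N+1,0}⋯v_{1,0} - v_{-1,0}⋯v_{-N-1,0})`. -/
theorem miura_to_Bogoyavlensky (N : ℕ) (hN : 1 ≤ N) (α : ℝ) (u : ℝ → ℤ → ℤ → ℝ)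
    (hne : ∀ (t : ℝ) (n m : ℤ), Qp (u t) (N + 1) 0 n m - α ≠ 0)
    (G : ℝ → ℤ → ℤ → ℝ)
    (hG : ∀ (t : ℝ) (n m : ℤ),
      G t n m = ∏ k ∈ Finset.range (N + 1),
        (Qp (u t) (N + 1) 0 (n + (k : ℤ) - (N : ℤ) - 1) m - α)⁻¹)
    (hflow : ∀ (n m : ℤ) (t : ℝ),
      HasDerivAt (fun s => u s n m) (u t n m * (G t (n + 1) m - G t n m)) t)
    (v : ℝ → ℤ → ℤ → ℝ)
    (hv : ∀ (t : ℝ) (n m : ℤ), v t n m = (Qp (u t) (N + 1) 0 n m - α)⁻¹) :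
    ∀ (t : ℝ) (n m : ℤ),
      HasDerivAt (fun s => v s n m)
        (-(v t n m) * (α * v t n m + 1) *
          (∏ i ∈ Finset.Icc 1 (N + 1), v t (n + (i : ℤ)) m -
            ∏ i ∈ Finset.Icc 1 (N + 1), v t (n - (i : ℤ)) m)) t := by
  intro t n m
  have hIcc (f : ℕ → ℝ) :
      ∏ i ∈ Finset.Icc 1 (N + 1), f i = ∏ k ∈ Finset.range (N + 1), f (k + 1) := by
    rw [Finset.range_eq_Ico, Finset.prod_Ico_add' f 0 (N + 1) 1]
    rfl
  have hright :
      G t (n + (N + 1 : ℕ) + 1) m = ∏ i ∈ Finset.Icc 1 (N + 1), v t (n + (i : ℤ)) m := by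
    rw [hG, hIcc]
    refine Finset.prod_congr rfl fun k _ => ?_
    rw [hv]
    congr 3
    push_cast
    ring
  have hleft : G t n m = ∏ i ∈ Finset.Icc 1 (N + 1), v t (n - (i : ℤ)) m := by
    rw [hG, hIcc, ← Finset.prod_range_reflect]
    refine Finset.prod_congr rfl fun k hk => ?_
    rw [hv]
    congr 3
    have := Finset.mem_range.mp hk
    omega
  have hQ := hasDerivAt_Qp_zero_right (g := fun n => G t n m) (fun n => hflow n m t) (N + 1) n
  simp only [hv _ n m]
  refine ((hQ.sub_const α).fun_inv (hne t n m)).congr_deriv ?_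
  rw [hright, hleft]
  have := hne t n m
  field_simp
  ring
end

section
/- Let N ≥ 1, c ∈ ℝ with c ≠ 0, and u : ℝ → ℤ × ℤ → ℝ with u(t,n,m) ≠ 0 for all t, n, m. For each t let Q^t_{(i,j)} denote the polynomials built from u(t,·,·), and set A(t,n,m) = Q^t_{(N−1,0)}(n,m) − c and B(t,n,m) = Q^t_{(N+1,0)}(n,m) − c, assumed nonzero for all t, n, m. Suppose that for every (n,m) and every t the function t ↦ u(t,n,m) has derivative u(t,n,m)·((∏_{i=0}^{N+1} A(t,n−N+i,m))/(∏_{i=0}^{N−1} B(t,n−N+i,m)))·((1/B(t,n,m) − 1/A(t,n+1,m)) − (1/B(t,n−N−1,m) − 1/A(t,n−N,m))) at t. Define R^t_{(N,1)}(n,m) = (∏_{k=0}^{N}∏_{l=0}^{1} u(t,n+k,m+l))·Q̃^t_{(N,1)}(−(n+N), m), where Q̃^t is built from the lattice function (a,b) ↦ (u(t,−a,b))⁻¹, and define E(t,n,m) = Q^t_{(N,1)}(n,m) + c − R^t_{(N,1)}(n,m) − (1/c)·∏_{i=0}^{N} (u(t,n+i,m)·u(t,n+i,m+1)). If at some time t₀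 one has E(t₀,n,m) = 0 for all (n,m) ∈ ℤ², then for every (n,m) the function t ↦ E(t,n,m) has derivative 0 at t₀. (The order N+1 flow (4.18) is a generalized symmetry in the first lattice direction of the deformed equation Q_{(N,1)} + c = R_{(N,1)} + (1/c)∏_{i=0}^{N} u_{i,0}u_{i,1}, which for N = 1 is Adler's Tzitzeica equation.) -/
/-- The polynomial `R_{(N,1)}`, obtained from `Q_{(N,1)}` by substituting
`u_{k,l} → 1/u_{-k,l}`, applying the shift `S^N`, and multiplying by
`∏_{k=0}^{N} ∏_{l=0}^{1} u_{k,l}`. -/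
noncomputable def Rp (N : ℕ) (u : ℤ → ℤ → ℝ) (n m : ℤ) : ℝ :=
  (∏ k ∈ Finset.range (N + 1), ∏ l ∈ Finset.range 2, u (n + (k : ℤ)) (m + (l : ℤ))) *
    Qp (fun a b => (u (-a) b)⁻¹) N 1 (-(n + (N : ℤ))) m

open Finset in
/-- A nowhere vanishing sequence on `ℤ` is the ratio sequence of a potential, normalised at `n`. -/
theorem exists_potential (w : ℤ → ℝ) (hw : ∀ k, w k ≠ 0) (n : ℤ) :
    ∃ φ : ℤ → ℝ, (∀ k, φ k ≠ 0) ∧ (∀ k, φ (k + 1) = φ k * w k) ∧ φ n = 1 := by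
  obtain ⟨φ, hφ, hs⟩ : ∃ φ : ℤ → ℝ, (∀ k, φ k ≠ 0) ∧ ∀ k, φ (k + 1) = φ k * w k := by
    refine ⟨fun k => (∏ i ∈ range k.toNat, w i) * (∏ i ∈ range (-k).toNat, w (-(i : ℤ) - 1))⁻¹,
      fun k => mul_ne_zero (prod_ne_zero_iff.2 fun _ _ => hw _)
        (inv_ne_zero (prod_ne_zero_iff.2 fun _ _ => hw _)), fun k => ?_⟩
    rcases k with j | j
    · have h1 : (Int.ofNat j + 1).toNat = j + 1 := by simp
      have h2 : (-(Int.ofNat j + 1)).toNat = 0 := by simp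
      have h3 : (-(Int.ofNat j)).toNat = 0 := by simp
      have h4 : (Int.ofNat j).toNat = j := by simp
      simp only [h1, h2, h3, h4, prod_range_succ]
      simp
    · have h1 : (Int.negSucc j + 1).toNat = 0 := by omega
      have h2 : (-(Int.negSucc j + 1)).toNat = j := by omega
      have h3 : (-(Int.negSucc j)).toNat = j + 1 := by omega
      have h4 : (Int.negSucc j).toNat = 0 := by omega
      have h5 : Int.negSucc j = -(j : ℤ) - 1 := by omega
      simp only [h1, h2, h3, h4, prod_range_succ]
      rw [h5]
      have := hw (-(j : ℤ) - 1)
      field_simp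
  exact ⟨fun k => φ k / φ n, fun k => div_ne_zero (hφ k) (hφ n),
    fun k => by simp only [hs k]; ring, div_self (hφ n)⟩

theorem potential_add {φ w : ℤ → ℝ} (hs : ∀ k, φ (k + 1) = φ k * w k) (n : ℤ) (j : ℕ) :
    φ (n + j) = φ n * ∏ i ∈ Finset.range j, w (n + i) := by
  induction j with
  | zero => simp
  | succ j ih =>
    rw [Finset.prod_range_succ, ← mul_assoc, ← ih, ← hs]
    congr 1; push_cast; ring

theorem prod_eq_potential_div {φ w : ℤ → ℝ} (hφ : ∀ k, φ k ≠ 0)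
    (hs : ∀ k, φ (k + 1) = φ k * w k) (n : ℤ) (j : ℕ) :
    ∏ i ∈ Finset.range j, w (n + i) = φ (n + j) / φ n := by
  rw [potential_add hs, mul_div_cancel_left₀ _ (hφ n)]

theorem Qp_zero_eq (u : ℤ → ℤ → ℝ) (m : ℤ) {φ : ℤ → ℝ} (hφ : ∀ k, φ k ≠ 0)
    (hs : ∀ k, φ (k + 1) = φ k * u k m) (i : ℕ) (n : ℤ) :
    Qp u i 0 n m = φ (n + i + 1) / φ n := by
  induction i with
  | zero => rw [Qp]; have := hφ n; simp [hs]; field_simp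
  | succ i ih =>
    rw [Qp, ih, hs (n + (i + 1 : ℕ)), show n + ((i + 1 : ℕ) : ℤ) = n + i + 1 by push_cast; ring]
    ring

/-- `Q_{(i,1)}` as a sum over the column in which the lattice path goes up. -/
theorem Qp_one_eq (u : ℤ → ℤ → ℝ) (m : ℤ) {φ ψ : ℤ → ℝ} (hφ : ∀ k, φ k ≠ 0) (hψ : ∀ k, ψ k ≠ 0)
    (hs : ∀ k, φ (k + 1) = φ k * u k m) (ht : ∀ k, ψ (k + 1) = ψ k * u k (m + 1))
    (i : ℕ) (n : ℤ) :
    Qp u i 1 n m =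
      ∑ j ∈ Finset.range (i + 1), φ (n + j + 1) / φ n * (ψ (n + i + 1) / ψ (n + j)) := by
  induction i with
  | zero =>
    have h1 := hφ n
    have h2 := hψ n
    simp [Qp, hs, ht]
    field_simp
  | succ i ih =>
    have h2 := hψ (n + i + 1)
    rw [Qp, ih, Finset.sum_range_succ _ (i + 1), Qp_zero_eq u m hφ hs,
      ht (n + (i + 1 : ℕ)), add_mul, add_comm, Finset.sum_mul]
    rw [show n + ((i + 1 : ℕ) : ℤ) = n + i + 1 by push_cast; ring]
    simp only [zero_add, Nat.cast_one]
    congr 1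
    · refine Finset.sum_congr rfl fun j _ => ?_
      ring
    · field_simp

theorem Rp_eq (N : ℕ) (u : ℤ → ℤ → ℝ) (hu : ∀ k l, u k l ≠ 0) (n m : ℤ) {φ ψ : ℤ → ℝ}
    (hφ : ∀ k, φ k ≠ 0) (hψ : ∀ k, ψ k ≠ 0)
    (hs : ∀ k, φ (k + 1) = φ k * u k m) (ht : ∀ k, ψ (k + 1) = ψ k * u k (m + 1)) :
    Rp N u n m =
      ∑ j ∈ Finset.range (N + 1), φ (n + j) / φ n * (ψ (n + N + 1) / ψ (n + j + 1)) := by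
  have reflect : ∀ {θ : ℤ → ℝ} {l : ℤ}, (∀ k, θ (k + 1) = θ k * u k l) →
      ∀ k, θ (1 - (k + 1)) = θ (1 - k) * (u (-k) l)⁻¹ := fun {θ l} h k => by
    rw [show 1 - k = -k + 1 by ring, h (-k), show 1 - (k + 1) = -k by ring,
      mul_assoc, mul_inv_cancel₀ (hu _ _), mul_one]
  rw [Rp, Qp_one_eq (fun a b => (u (-a) b)⁻¹) m (φ := fun k => φ (1 - k))
    (ψ := fun k => ψ (1 - k)) (fun _ => hφ _) (fun _ => hψ _) (reflect hs) (reflect ht)]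
  simp only [Finset.prod_range_succ _ 1, Finset.prod_range_one, Finset.prod_mul_distrib,
    Nat.cast_zero, add_zero, Nat.cast_one]
  rw [prod_eq_potential_div (w := fun k => u k m) hφ hs,
    prod_eq_potential_div (w := fun k => u k (m + 1)) hψ ht, Finset.mul_sum,
    ← Finset.sum_range_reflect]
  refine Finset.sum_congr rfl fun j hj => ?_
  have hj' : j ≤ N := Nat.lt_succ_iff.1 (Finset.mem_range.1 hj)
  have h1 := hφ n
  have h2 := hψ n
  have h3 := hφ (n + N + 1)
  have h4 := hψ (n + j + 1)
  have e : ((N + 1 - 1 - j : ℕ) : ℤ) = N - j := by omega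
  have e1 : 1 - (-(n + (N : ℤ)) + (N - j) + 1) = n + j := by ring
  have e2 : 1 - -(n + (N : ℤ)) = n + N + 1 := by ring
  have e3 : 1 - (-(n + (N : ℤ)) + N + 1) = n := by ring
  have e4 : 1 - (-(n + (N : ℤ)) + (N - j)) = n + j + 1 := by ring
  rw [e, e1, e2, e3, e4, Nat.cast_add, Nat.cast_one, ← add_assoc]
  field_simp

/-- The summand of the deformed equation written through the row potentials. -/
noncomputable def pathTerm (φ ψ : ℤ → ℝ) (k : ℤ) : ℝ :=
  φ (k + 1) / ψ k - φ k / ψ (k + 1)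

theorem deformed_eq (N : ℕ) (c : ℝ) (u : ℤ → ℤ → ℝ) (hu : ∀ k l, u k l ≠ 0) (n m : ℤ)
    {φ ψ : ℤ → ℝ} (hφ : ∀ k, φ k ≠ 0) (hψ : ∀ k, ψ k ≠ 0)
    (hs : ∀ k, φ (k + 1) = φ k * u k m) (ht : ∀ k, ψ (k + 1) = ψ k * u k (m + 1)) :
    Qp u N 1 n m + c - Rp N u n m
        - (1 / c) * ∏ i ∈ Finset.range (N + 1), (u (n + (i : ℤ)) m * u (n + (i : ℤ)) (m + 1))
      = ψ (n + N + 1) / φ n * (∑ j ∈ Finset.range (N + 1), pathTerm φ ψ (n + j)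
          + c * φ n / ψ (n + N + 1) - φ (n + N + 1) / (c * ψ n)) := by
  have h1 := hφ n
  have h2 := hψ (n + N + 1)
  rw [Qp_one_eq u m hφ hψ hs ht, Rp_eq N u hu n m hφ hψ hs ht, Finset.prod_mul_distrib,
    prod_eq_potential_div (w := fun k => u k m) hφ hs,
    prod_eq_potential_div (w := fun k => u k (m + 1)) hψ ht, Nat.cast_add, Nat.cast_one,
    ← add_assoc, mul_sub, mul_add, Finset.mul_sum]
  simp only [pathTerm, mul_sub, Finset.sum_sub_distrib]
  have e1 : ψ (n + N + 1) / φ n * (c * φ n / ψ (n + N + 1)) = c := by field_simp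
  have e2 : ∀ x y : ℝ, x / φ n * (ψ (n + N + 1) / y) = ψ (n + N + 1) / φ n * (x / y) :=
    fun x y => by ring
  simp only [e1, e2]
  ring

/-- Two neighbouring instances of the deformed equation imply a factorised relation
between the two rows. -/
theorem factorised_relation (N : ℕ) (c : ℝ) (hc : c ≠ 0) {φ ψ : ℤ → ℝ}
    (hφ : ∀ k, φ k ≠ 0) (hψ : ∀ k, ψ k ≠ 0)
    (hsol : ∀ k : ℤ, ∑ j ∈ Finset.range (N + 1), pathTerm φ ψ (k + j)
          + c * φ k / ψ (k + N + 1) - φ (k + N + 1) / (c * ψ k) = 0) (k : ℤ) :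
    φ (k + 1) / φ k * (ψ (k + N + 2) / ψ k - c) * (φ (k + N + 1) / φ (k + 1) - c)
      = ψ (k + N + 2) / ψ (k + N + 1) * (φ (k + N + 2) / φ k - c) *
          (ψ (k + N + 1) / ψ (k + 1) - c) := by
  have H0 := hsol k
  have H1 := hsol (k + 1)
  rw [Finset.sum_range_succ'] at H0
  rw [Finset.sum_range_succ] at H1
  have e : ∑ j ∈ Finset.range N, pathTerm φ ψ (k + ((j + 1 : ℕ) : ℤ))
      = ∑ j ∈ Finset.range N, pathTerm φ ψ (k + 1 + j) :=
    Finset.sum_congr rfl fun j _ => by congr 1; push_cast; ring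
  rw [e] at H0
  rw [show k + 1 + (N : ℤ) + 1 = k + N + 2 by ring, show k + 1 + (N : ℤ) = k + N + 1 by ring] at H1
  simp only [pathTerm, Nat.cast_zero, add_zero] at H0 H1
  rw [show k + (N : ℤ) + 1 + 1 = k + N + 2 by ring] at H1
  have h0 := hφ k
  have h1 := hφ (k + 1)
  have h2 := hψ k
  have h3 := hψ (k + 1)
  have h4 := hψ (k + N + 1)
  have h5 := hψ (k + N + 2)
  set S := ∑ j ∈ Finset.range N, pathTerm φ ψ (k + 1 + j)
  have D : φ (k + N + 2) / ψ (k + N + 1) - φ (k + N + 1) / ψ (k + N + 2)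
      - (φ (k + 1) / ψ k - φ k / ψ (k + 1)) + c * φ (k + 1) / ψ (k + N + 2)
      - φ (k + N + 2) / (c * ψ (k + 1)) - c * φ k / ψ (k + N + 1)
      + φ (k + N + 1) / (c * ψ k) = 0 := by
    linear_combination H1 - H0
  rw [← sub_eq_zero, ← mul_zero (c * ψ (k + N + 2) / φ k), ← D]
  field_simp
  ring

theorem telescoping_step (c p0 p1 p2 p3 p4 p5 q0 q1 q2 q3 q4 q5 r0 r1 ρ s τ : ℝ)
    (hc : c ≠ 0) (hp0 : p0 ≠ 0) (hp1 : p1 ≠ 0) (hp2 : p2 ≠ 0) (hp3 : p3 ≠ 0)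
    (hq0 : q0 ≠ 0) (hq1 : q1 ≠ 0) (hq2 : q2 ≠ 0) (hq3 : q3 ≠ 0) (hq4 : q4 ≠ 0) (hq5 : q5 ≠ 0)
    (h1 : r1 * (p5 / p2 - c) = p4 / p3 - c)
    (h2 : r0 * (p3 / p0 - c) = p2 / p1 - c)
    (h3 : p3 / p2 * (q4 / q5) * r1 * (q5 / q2 - c) = q4 / q3 - c)
    (h4 : p1 / p0 * (q2 / q3) * r0 * (q3 / q0 - c) = q2 / q1 - c) :
    ρ * r1 * (q3 / p1) *
        ((s - (p3 / q2 - p2 / q3) + p3 / (c * q1)) * (τ + (p3 / q2 - p2 / q3) + p5 / (c * q3))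
          - (τ + (p3 / q2 - p2 / q3) + c * p1 / q3) * (s - (p3 / q2 - p2 / q3) + c * p3 / q5))
      = ρ * r0 * (q2 / p0) *
          ((s + p2 / (c * q0)) * (τ + p4 / (c * q2)) - (τ + c * p0 / q2) * (s + c * p2 / q4))
        + ((s + p2 / q3) * (ρ * ((p2 / p1 - c) * (r1 - 1) - (p4 / p3 - c) * (r0 - 1)))
        + (τ + p3 / q2) * (ρ * (p2 / p1 * (q3 / q4)) *
            ((q2 / q1 - c) * (p3 / p2 * (q4 / q5) * r1 - 1)
              - (q4 / q3 - c) * (p1 / p0 * (q2 / q3) * r0 - 1)))) := by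
  obtain ⟨α, hα⟩ : ∃ α, α = r1 * p5 := ⟨_, rfl⟩
  obtain ⟨β, hβ⟩ : ∃ β, β = r1 / q5 := ⟨_, rfl⟩
  obtain ⟨γ, hγ⟩ : ∃ γ, γ = r0 / p0 := ⟨_, rfl⟩
  obtain ⟨δ, hδ⟩ : ∃ δ, δ = r0 / (p0 * q0) := ⟨_, rfl⟩
  have e1 : α = p2 * (r1 * c + p4 / p3 - c) := by
    rw [hα, add_sub_assoc, ← h1]; field_simp; ring
  have e2 : γ = (r0 * c + p2 / p1 - c) / p3 := by
    rw [hγ, add_sub_assoc, ← h2]; field_simp; ring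
  have e3 : β = (p3 / p2 * (q4 / q2) * r1 - (q4 / q3 - c)) * p2 / (c * p3 * q4) := by
    rw [hβ, ← h3]; field_simp; ring
  have e4 : δ = (q2 / q1 - c) / (p1 * q2) + c * γ / q3 := by
    rw [hδ, ← h4, hγ]; field_simp; ring
  have L : ρ * r1 * (q3 / p1) *
        ((s - (p3 / q2 - p2 / q3) + p3 / (c * q1)) * (τ + (p3 / q2 - p2 / q3) + p5 / (c * q3))
          - (τ + (p3 / q2 - p2 / q3) + c * p1 / q3) * (s - (p3 / q2 - p2 / q3) + c * p3 / q5))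
      = ρ * (q3 / p1) *
        ((s - (p3 / q2 - p2 / q3) + p3 / (c * q1)) * (r1 * (τ + (p3 / q2 - p2 / q3)) + α / (c * q3))
          - (τ + (p3 / q2 - p2 / q3) + c * p1 / q3) *
            (r1 * (s - (p3 / q2 - p2 / q3)) + c * p3 * β)) := by
    rw [hα, hβ]; ring
  have M : ρ * r0 * (q2 / p0) *
          ((s + p2 / (c * q0)) * (τ + p4 / (c * q2)) - (τ + c * p0 / q2) * (s + c * p2 / q4))
      = ρ * q2 * ((γ * s + p2 * δ / c) * (τ + p4 / (c * q2))
          - (γ * τ + c * r0 / q2) * (s + c * p2 / q4)) := by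
    rw [hγ, hδ]; field_simp
  have m1 : p3 / p2 * (q4 / q5) * r1 = p3 / p2 * q4 * β := by rw [hβ]; ring
  have m2 : p1 / p0 * (q2 / q3) * r0 = p1 * (q2 / q3) * γ := by rw [hγ]; ring
  rw [L, M, m1, m2, e4, e1, e3, e2]
  field_simp
  ring

/-- The logarithmic velocity of the flow, in terms of the potential `φ` of a row and the
potential `χ` of the ratios `A_{k+1} / B_k`. -/
noncomputable def rowFlow (N : ℕ) (c : ℝ) (φ χ : ℤ → ℝ) (k : ℤ) : ℝ :=
  χ k / χ (k - N) * ((φ k / φ (k - N) - c) * (χ (k + 1) / χ k - 1)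
    - (φ (k + N + 1) / φ (k + 1) - c) * (χ (k - N) / χ (k - N - 1) - 1))

theorem flow_eq_rowFlow (N : ℕ) (c : ℝ) {a b φ χ : ℤ → ℝ} (ha : ∀ k, a k ≠ 0)
    (hb : ∀ k, b k ≠ 0) (haφ : ∀ k, a k = φ (k + N) / φ k - c) (hχ : ∀ k, χ k ≠ 0)
    (hr : ∀ k, χ (k + 1) = χ k * (a (k + 1) / b k)) (k : ℤ) :
    ((∏ i ∈ Finset.range (N + 2), a (k - N + i)) / (∏ i ∈ Finset.range N, b (k - N + i))) *
        ((1 / b k - 1 / a (k + 1)) - (1 / b (k - N - 1) - 1 / a (k - N)))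
      = rowFlow N c φ χ k := by
  have e0 := haφ (k - N)
  have e1 := haφ (k + 1)
  rw [sub_add_cancel] at e0
  rw [show k + 1 + (N : ℤ) = k + N + 1 by ring] at e1
  have P := prod_eq_potential_div hχ hr (k - N) N
  rw [sub_add_cancel, Finset.prod_div_distrib] at P
  have hr0 := hr (k - N - 1)
  rw [sub_add_cancel] at hr0
  have e2 : ∏ i ∈ Finset.range N, a (k - N + ((i + 1 : ℕ) : ℤ))
      = ∏ i ∈ Finset.range N, a (k - N + i + 1) :=
    Finset.prod_congr rfl fun j _ => by congr 1; push_cast; ring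
  rw [rowFlow, ← e0, ← e1, ← P, Finset.prod_range_succ, Finset.prod_range_succ', e2, hr k, hr0,
    show k - N + ((N + 1 : ℕ) : ℤ) = k + 1 by push_cast; ring, Nat.cast_zero, add_zero]
  have h1 := ha (k - N)
  have h2 := ha (k + 1)
  have h3 := hb k
  have h4 := hb (k - N - 1)
  have h5 := hχ k
  have h6 := hχ (k - N - 1)
  field_simp

/-- The ratio potential of the upper row, in terms of that of the lower row. -/
noncomputable def upperPotential (N : ℕ) (φ ψ χ : ℤ → ℝ) (k : ℤ) : ℝ :=
  χ k * φ k / ψ (k + N + 1)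

/-- A weighted determinant of two planar vectors; its increments in `k` are the contributions of
the individual lattice sites to the derivative of the deformed equation. -/
noncomputable def siteDet (N : ℕ) (c : ℝ) (φ ψ χ : ℤ → ℝ) (k : ℤ) (s τ : ℝ) : ℝ :=
  χ k / χ (k - N - 1) * (ψ k / φ (k - N - 1)) *
    ((s + φ k / (c * ψ (k - N - 1))) * (τ + φ (k + N + 1) / (c * ψ k))
      - (τ + c * φ (k - N - 1) / ψ k) * (s + c * φ k / ψ (k + N + 1)))

theorem siteDet_succ (N : ℕ) (c : ℝ) (hc : c ≠ 0) {φ ψ χ : ℤ → ℝ} (hφ : ∀ k, φ k ≠ 0)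
    (hψ : ∀ k, ψ k ≠ 0) (hχ : ∀ k, χ k ≠ 0)
    (h : ∀ k, χ (k + 1) / χ k * (φ (k + N + 2) / φ k - c) = φ (k + N + 1) / φ (k + 1) - c)
    (h' : ∀ k, upperPotential N φ ψ χ (k + 1) / upperPotential N φ ψ χ k *
      (ψ (k + N + 2) / ψ k - c) = ψ (k + N + 1) / ψ (k + 1) - c) (k : ℤ) (s τ : ℝ) :
    siteDet N c φ ψ χ (k + 1) (s - pathTerm φ ψ k) (τ + pathTerm φ ψ k)
      = siteDet N c φ ψ χ k s τ
        + ((s + φ k / ψ (k + 1)) * rowFlow N c φ χ k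
          + (τ + φ (k + 1) / ψ k) * rowFlow N c ψ (upperPotential N φ ψ χ) k) := by
  have ratio : ∀ j, upperPotential N φ ψ χ (j + 1) / upperPotential N φ ψ χ j
      = φ (j + 1) / φ j * (ψ (j + N + 1) / ψ (j + N + 2)) * (χ (j + 1) / χ j) := fun j => by
    have h1 := hφ j
    have h2 := hψ (j + N + 1)
    have h3 := hψ (j + N + 2)
    have h4 := hχ j
    rw [upperPotential, upperPotential, show j + 1 + (N : ℤ) + 1 = j + N + 2 by ring]
    field_simp
  have e1 : k - N - 1 + 1 = k - N := by ring
  have e2 : k - N - 1 + N + 2 = k + 1 := by ring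
  have e3 : k - N - 1 + N + 1 = k := by ring
  have e4 : k + 1 - N - 1 = k - N := by ring
  have e5 : k + 1 + N + 1 = k + N + 2 := by ring
  have H1 := h k
  have H2 := h (k - N - 1)
  have H3 := h' k
  have H4 := h' (k - N - 1)
  have R := ratio (k - N - 1)
  rw [ratio] at H3 H4
  rw [e1, e2, e3] at H2 H4 R
  have key := telescoping_step c _ _ _ _ _ _ _ _ _ _ _ _ _ _ (χ k / χ (k - N)) s τ hc
    (hφ _) (hφ _) (hφ _) (hφ _) (hψ _) (hψ _) (hψ _) (hψ _) (hψ _) (hψ _) H1 H2 H3 H4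
  have c1 := hχ k
  have c2 := hχ (k - N)
  have U : upperPotential N φ ψ χ k / upperPotential N φ ψ χ (k - N)
      = χ k / χ (k - N) * (φ k / φ (k - N) * (ψ (k + 1) / ψ (k + N + 1))) := by
    have h1 := hφ (k - N)
    have h2 := hψ (k + N + 1)
    have h3 := hψ (k + 1)
    rw [upperPotential, upperPotential, sub_add_cancel]
    field_simp
  rw [siteDet, siteDet, rowFlow, rowFlow, ratio k, R, U, e4, e5, pathTerm]
  rw [div_mul_div_cancel₀' c1] at key
  rw [div_mul_div_cancel₀ c2] at key
  exact key

theorem hasDerivAt_prod_of_log_velocity {w : ℝ → ℤ → ℝ} {g : ℤ → ℝ} {t : ℝ}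
    (hw : ∀ k, HasDerivAt (fun s => w s k) (w t k * g k) t) (n : ℤ) (j : ℕ) :
    HasDerivAt (fun s => ∏ i ∈ Finset.range j, w s (n + i))
      ((∏ i ∈ Finset.range j, w t (n + i)) * ∑ i ∈ Finset.range j, g (n + i)) t := by
  induction j with
  | zero => simpa using hasDerivAt_const t (1 : ℝ)
  | succ j ih =>
    simp only [Finset.prod_range_succ, Finset.sum_range_succ]
    exact (ih.mul (hw _)).congr_deriv (by ring)

theorem siteDet_eq_add_sum (N : ℕ) (c : ℝ) (hc : c ≠ 0) {φ ψ χ : ℤ → ℝ} (hφ : ∀ k, φ k ≠ 0)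
    (hψ : ∀ k, ψ k ≠ 0) (hχ : ∀ k, χ k ≠ 0)
    (h : ∀ k, χ (k + 1) / χ k * (φ (k + N + 2) / φ k - c) = φ (k + N + 1) / φ (k + 1) - c)
    (h' : ∀ k, upperPotential N φ ψ χ (k + 1) / upperPotential N φ ψ χ k *
      (ψ (k + N + 2) / ψ k - c) = ψ (k + N + 1) / ψ (k + 1) - c)
    {Γ Γ' : ℕ → ℝ} {n : ℤ} (hΓ0 : Γ 0 = 0) (hΓ0' : Γ' 0 = 0)
    (hΓ : ∀ j : ℕ, Γ (j + 1) = Γ j + rowFlow N c φ χ (n + j))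
    (hΓ' : ∀ j : ℕ, Γ' (j + 1) = Γ' j + rowFlow N c ψ (upperPotential N φ ψ χ) (n + j))
    (s τ : ℝ) (M : ℕ) :
    siteDet N c φ ψ χ (n + M) (s - ∑ j ∈ Finset.range M, pathTerm φ ψ (n + j))
        (τ + ∑ j ∈ Finset.range M, pathTerm φ ψ (n + j))
      = siteDet N c φ ψ χ n s τ
        + (s - ∑ j ∈ Finset.range M, pathTerm φ ψ (n + j)) * Γ M
        + (τ + ∑ j ∈ Finset.range M, pathTerm φ ψ (n + j)) * Γ' M
        + ∑ j ∈ Finset.range M,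
          (φ (n + j + 1) / ψ (n + j) * (Γ (j + 1) - Γ' j)
            - φ (n + j) / ψ (n + j + 1) * (Γ j - Γ' (j + 1))) := by
  induction M with
  | zero => simp [hΓ0, hΓ0']
  | succ M ih =>
    simp only [Finset.sum_range_succ]
    rw [← sub_sub, ← add_assoc, show n + ((M + 1 : ℕ) : ℤ) = n + M + 1 by push_cast; ring,
      siteDet_succ N c hc hφ hψ hχ h h', ih, hΓ, hΓ', pathTerm]
    ring

theorem deformed_eq_prod (N : ℕ) (c : ℝ) (u : ℤ → ℤ → ℝ) (hu : ∀ k l, u k l ≠ 0) (n m : ℤ) :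
    Qp u N 1 n m + c - Rp N u n m
        - (1 / c) * ∏ i ∈ Finset.range (N + 1), (u (n + (i : ℤ)) m * u (n + (i : ℤ)) (m + 1))
      = (∏ i ∈ Finset.range (N + 1), u (n + i) (m + 1)) *
          ∑ j ∈ Finset.range (N + 1),
            ((∏ i ∈ Finset.range (j + 1), u (n + i) m) / (∏ i ∈ Finset.range j, u (n + i) (m + 1))
            - (∏ i ∈ Finset.range j, u (n + i) m)
              / (∏ i ∈ Finset.range (j + 1), u (n + i) (m + 1)))
        + c - (∏ i ∈ Finset.range (N + 1), u (n + i) m) *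
          (∏ i ∈ Finset.range (N + 1), u (n + i) (m + 1)) / c := by
  obtain ⟨φ, hφ, hs, hφn⟩ := exists_potential (fun k => u k m) (fun k => hu k m) n
  obtain ⟨ψ, hψ, ht, hψn⟩ := exists_potential (fun k => u k (m + 1)) (fun k => hu k (m + 1)) n
  have P : ∀ j : ℕ, ∏ i ∈ Finset.range j, u (n + i) m = φ (n + j) := fun j => by
    rw [potential_add hs, hφn, one_mul]
  have P' : ∀ j : ℕ, ∏ i ∈ Finset.range j, u (n + i) (m + 1) = ψ (n + j) := fun j => by
    rw [potential_add ht, hψn, one_mul]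
  rw [deformed_eq N c u hu n m hφ hψ hs ht]
  simp only [P, P', pathTerm, hφn, hψn, Nat.cast_add, Nat.cast_one, ← add_assoc]
  have := hψ (n + N + 1)
  field_simp

/-- the order `N+1` flow (4.18) is a generalized symmetry in the first lattice
direction of the deformed equation
`Q_{(N,1)} + c = R_{(N,1)} + (1/c)∏_{i=0}^{N} u_{i,0} u_{i,1}`,
which for `N = 1` is Adler's Tzitzeica equation. -/
theorem symmetry_deformed_hierarchy (N : ℕ) (hN : 1 ≤ N) (c : ℝ) (hc : c ≠ 0)
    (u : ℝ → ℤ → ℤ → ℝ)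
    (hu : ∀ (t : ℝ) (n m : ℤ), u t n m ≠ 0)
    (A B : ℝ → ℤ → ℤ → ℝ)
    (hA : ∀ (t : ℝ) (n m : ℤ), A t n m = Qp (u t) (N - 1) 0 n m - c)
    (hB : ∀ (t : ℝ) (n m : ℤ), B t n m = Qp (u t) (N + 1) 0 n m - c)
    (hAne : ∀ (t : ℝ) (n m : ℤ), A t n m ≠ 0)
    (hBne : ∀ (t : ℝ) (n m : ℤ), B t n m ≠ 0)
    (hflow : ∀ (n m : ℤ) (t : ℝ),
      HasDerivAt (fun s => u s n m)
        (u t n m *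
          ((∏ i ∈ Finset.range (N + 2), A t (n - (N : ℤ) + (i : ℤ)) m) /
            (∏ i ∈ Finset.range N, B t (n - (N : ℤ) + (i : ℤ)) m)) *
          ((1 / B t n m - 1 / A t (n + 1) m)
            - (1 / B t (n - (N : ℤ) - 1) m - 1 / A t (n - (N : ℤ)) m))) t)
    (E : ℝ → ℤ → ℤ → ℝ)
    (hE : ∀ (t : ℝ) (n m : ℤ),
      E t n m = Qp (u t) N 1 n m + c - Rp N (u t) n m
        - (1 / c) * ∏ i ∈ Finset.range (N + 1), (u t (n + (i : ℤ)) m * u t (n + (i : ℤ)) (m+1)))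
    (t₀ : ℝ) (hsol : ∀ n m : ℤ, E t₀ n m = 0) :
    ∀ n m : ℤ, HasDerivAt (fun s => E s n m) 0 t₀ := by
  intro n m
  obtain ⟨φ, hφ, hs, hφn⟩ := exists_potential (fun k => u t₀ k m) (fun k => hu t₀ k m) n
  obtain ⟨ψ, hψ, ht, hψn⟩ :=
    exists_potential (fun k => u t₀ k (m + 1)) (fun k => hu t₀ k (m + 1)) n
  obtain ⟨χ, hχ, hr, -⟩ := exists_potential (fun k => A t₀ (k + 1) m / B t₀ k m)
    (fun k => div_ne_zero (hAne _ _ _) (hBne _ _ _)) n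
  have hAφ : ∀ k, A t₀ k m = φ (k + N) / φ k - c := fun k => by
    rw [hA, Qp_zero_eq (u t₀) m hφ hs, Nat.cast_sub hN]
    congr 3; push_cast; ring
  have hBφ : ∀ k, B t₀ k m = φ (k + N + 2) / φ k - c := fun k => by
    rw [hB, Qp_zero_eq (u t₀) m hφ hs]
    congr 3; push_cast; ring
  have hAψ : ∀ k, A t₀ k (m + 1) = ψ (k + N) / ψ k - c := fun k => by
    rw [hA, Qp_zero_eq (u t₀) (m + 1) hψ ht, Nat.cast_sub hN]
    congr 3; push_cast; ring
  have hBψ : ∀ k, B t₀ k (m + 1) = ψ (k + N + 2) / ψ k - c := fun k => by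
    rw [hB, Qp_zero_eq (u t₀) (m + 1) hψ ht]
    congr 3; push_cast; ring
  have shift : ∀ k : ℤ, k + 1 + (N : ℤ) = k + N + 1 := fun k => by ring
  have sol : ∀ k : ℤ, ∑ j ∈ Finset.range (N + 1), pathTerm φ ψ (k + j)
      + c * φ k / ψ (k + N + 1) - φ (k + N + 1) / (c * ψ k) = 0 := fun k => by
    have h0 := hsol k m
    rw [hE, deformed_eq N c (u t₀) (hu t₀) k m hφ hψ hs ht] at h0
    exact (mul_eq_zero.1 h0).resolve_left (div_ne_zero (hψ _) (hφ _))
  have hχ' : ∀ k, upperPotential N φ ψ χ k ≠ 0 := fun k =>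
    div_ne_zero (mul_ne_zero (hχ _) (hφ _)) (hψ _)
  have hr' : ∀ k, upperPotential N φ ψ χ (k + 1)
      = upperPotential N φ ψ χ k * (A t₀ (k + 1) (m + 1) / B t₀ k (m + 1)) := fun k => by
    have F := factorised_relation N c hc hφ hψ sol k
    rw [← shift k, ← hBψ, ← hBφ, ← hAφ, ← hAψ, shift] at F
    have h1 := hBne t₀ k m
    have h2 := hBne t₀ k (m + 1)
    have h3 := hφ k
    have h4 := hψ (k + N + 1)
    have h5 := hψ (k + N + 2)
    rw [upperPotential, upperPotential, hr, show k + 1 + (N : ℤ) + 1 = k + N + 2 by ring]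
    field_simp at F ⊢
    linear_combination χ k * F
  have R : ∀ k, χ (k + 1) / χ k * (φ (k + N + 2) / φ k - c) = φ (k + N + 1) / φ (k + 1) - c :=
    fun k => by
      rw [← shift k, ← hBφ, ← hAφ, hr, mul_div_cancel_left₀ _ (hχ k), div_mul_cancel₀ _ (hBne _ _ _)]
  have R' : ∀ k, upperPotential N φ ψ χ (k + 1) / upperPotential N φ ψ χ k *
      (ψ (k + N + 2) / ψ k - c) = ψ (k + N + 1) / ψ (k + 1) - c := fun k => by
    rw [← shift k, ← hBψ, ← hAψ, hr', mul_div_cancel_left₀ _ (hχ' k),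
      div_mul_cancel₀ _ (hBne _ _ _)]
  have velocity : ∀ k, HasDerivAt (fun s => u s k m) (u t₀ k m * rowFlow N c φ χ k) t₀ :=
    fun k => by
      rw [← flow_eq_rowFlow N c (a := fun k => A t₀ k m) (b := fun k => B t₀ k m)
        (fun _ => hAne _ _ _) (fun _ => hBne _ _ _) hAφ hχ hr k, ← mul_assoc]
      exact hflow k m t₀
  have velocity' : ∀ k, HasDerivAt (fun s => u s k (m + 1))
      (u t₀ k (m + 1) * rowFlow N c ψ (upperPotential N φ ψ χ) k) t₀ := fun k => by
    rw [← flow_eq_rowFlow N c (a := fun k => A t₀ k (m + 1)) (b := fun k => B t₀ k (m + 1))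
      (fun _ => hAne _ _ _) (fun _ => hBne _ _ _) hAψ hχ' hr' k, ← mul_assoc]
    exact hflow k (m + 1) t₀
  have D := hasDerivAt_prod_of_log_velocity (w := fun s k => u s k m) velocity n
  have D' := hasDerivAt_prod_of_log_velocity (w := fun s k => u s k (m + 1)) velocity' n
  have hP : ∀ j : ℕ, ∏ i ∈ Finset.range j, u t₀ (n + i) m = φ (n + j) := fun j => by
    rw [potential_add hs, hφn, one_mul]
  have hP' : ∀ j : ℕ, ∏ i ∈ Finset.range j, u t₀ (n + i) (m + 1) = ψ (n + j) := fun j => by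
    rw [potential_add ht, hψn, one_mul]
  have ne' : ∀ j : ℕ, ∏ i ∈ Finset.range j, u t₀ (n + i) (m + 1) ≠ 0 := fun j =>
    Finset.prod_ne_zero_iff.2 fun _ _ => hu _ _ _
  have T := siteDet_eq_add_sum N c hc hφ hψ hχ R R'
    (Γ := fun j => ∑ i ∈ Finset.range j, rowFlow N c φ χ (n + i))
    (Γ' := fun j => ∑ i ∈ Finset.range j, rowFlow N c ψ (upperPotential N φ ψ χ) (n + i))
    (n := n) rfl rfl (fun j => Finset.sum_range_succ _ j) (fun j => Finset.sum_range_succ _ j)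
    (-(c * φ n / ψ (n + N + 1))) (-(φ (n + N + 1) / (c * ψ n))) (N + 1)
  have start : siteDet N c φ ψ χ n (-(c * φ n / ψ (n + N + 1))) (-(φ (n + N + 1) / (c * ψ n)))
      = 0 := by
    rw [siteDet]; ring
  have sum_eq : ∑ j ∈ Finset.range (N + 1), pathTerm φ ψ (n + j)
      = φ (n + N + 1) / (c * ψ n) - c * φ n / ψ (n + N + 1) := by
    linear_combination sol n
  have finish : siteDet N c φ ψ χ (n + ((N + 1 : ℕ) : ℤ)) (-(φ (n + N + 1) / (c * ψ n)))
      (-(c * φ n / ψ (n + N + 1))) = 0 := by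
    rw [siteDet, show n + ((N + 1 : ℕ) : ℤ) = n + N + 1 by push_cast; ring,
      show n + (N : ℤ) + 1 - N - 1 = n by ring]
    ring
  have total := ((((D' (N + 1)).mul (HasDerivAt.fun_sum fun j (_ : j ∈ Finset.range (N + 1)) =>
    ((D (j + 1)).div (D' j) (ne' j)).sub ((D j).div (D' (j + 1)) (ne' (j + 1))))).add_const c).sub
    (((D (N + 1)).mul (D' (N + 1))).div_const c))
  have hfun : (fun s => E s n m) = _ :=
    funext fun s => (hE s n m).trans (deformed_eq_prod N c (u s) (hu s) n m)
  rw [hfun]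
  refine total.congr_deriv ?_
  have quotient : ∀ x y g h : ℝ, y ≠ 0 →
      (x * g * y - x * (y * h)) / y ^ 2 = x / y * (g - h) := fun x y g h hy => by field_simp
  have sub_sum : -(c * φ n / ψ (n + N + 1)) - (φ (n + N + 1) / (c * ψ n) - c * φ n / ψ (n + N + 1))
      = -(φ (n + N + 1) / (c * ψ n)) := by ring
  have add_sum : -(φ (n + N + 1) / (c * ψ n)) + (φ (n + N + 1) / (c * ψ n) - c * φ n / ψ (n + N + 1))
      = -(c * φ n / ψ (n + N + 1)) := by ring
  rw [sum_eq, sub_sum, add_sum, start, finish] at T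
  simp only [pathTerm] at sum_eq
  simp only [quotient _ _ _ _ (ne' _)]
  simp only [Pi.sub_apply, Pi.div_apply, hP, hP', Nat.cast_add, Nat.cast_one, ← add_assoc, sum_eq]
  simp only [hφn, hψn] at T ⊢
  linear_combination -ψ (n + N + 1) * T
end
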